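/- arXiv:2211.13284 — 2 statements merged into one kernel-verified Lean document; each statement's English description precedes it below -/
import Mathlib

section
/- The recursively defined operators 𝒫^l are the completely symmetric trace-free projectors: for every l ≥ 2 and every n = 1,…,l−1 one has 𝒫^l 𝒫⁻_{n(n+1)} = 0, 𝒫^l 𝒫ᵗ_{n(n+1)} = 0, 𝒫⁻_{n(n+1)} 𝒫^l = 0, 𝒫ᵗ_{n(n+1)} 𝒫^l = 0, and (𝒫^l)² = 𝒫^l; each 𝒫^l is symmetric, i.e. its matrix satisfies 𝒫^l{}^{i_1…i_l}_{j_1…j_l} = 𝒫^l{}^{j_1…j_l}_{i_1…i_l}; and 𝒫^{l+1} also equals 𝒫^l_{2…(l+1)} M(l+1)_{12} 𝒫^l_{2…(l+1)}, i.e. the same recursion performed on the last l tensor factors gives the same operator. -/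
open scoped BigOperators

noncomputable section
namespace Fuzzy

/-- Matrices acting on `ℂ^D ⊗ ℂ^D`, indexed by pairs. -/
abbrev PairMat (D : ℕ) := Matrix (Fin D × Fin D) (Fin D × Fin D) ℂ

/-- The flip (permutation) operator `𝖯` on `ℂ^D ⊗ ℂ^D`: `𝖯^{hi}_{jk} = δ^h_k δ^i_j`. -/
def flipMat (D : ℕ) : PairMat D := fun p q => if p.1 = q.2 ∧ p.2 = q.1 then 1 else 0

/-- The trace projector `𝒫ᵗ`: `𝒫ᵗ{}^{hi}_{jk} = δ^{hi} δ_{jk} / D`. -/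
def traceMat (D : ℕ) : PairMat D :=
  fun p q => (if p.1 = p.2 then 1 else 0) * (if q.1 = q.2 then 1 else 0) / (D : ℂ)

/-- The symmetric projector `𝒫⁺ = (1 + 𝖯)/2`. -/
def symPlusMat (D : ℕ) : PairMat D := (2 : ℂ)⁻¹ • ((1 : PairMat D) + flipMat D)

/-- The antisymmetric projector `𝒫⁻ = (1 − 𝖯)/2`. -/
def symMinusMat (D : ℕ) : PairMat D := (2 : ℂ)⁻¹ • ((1 : PairMat D) - flipMat D)

/-- The trace-free symmetric projector `𝒫 = 𝒫⁺ − 𝒫ᵗ`. -/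
def PsMat (D : ℕ) : PairMat D := symPlusMat D - traceMat D

/-- `𝒫′ = 𝒫⁻ + 𝒫ᵗ`. -/
def PprimeMat (D : ℕ) : PairMat D := symMinusMat D + traceMat D

/-- Embedding of an operator on `ℂ^D ⊗ ℂ^D` acting on the tensor factors `n, n+1`
(0-based) of `(ℂ^D)^{⊗ l}`, and as the identity on the other factors. -/
def embAt (D l n : ℕ) (A : PairMat D) :
    Matrix (Fin l → Fin D) (Fin l → Fin D) ℂ := fun i j =>
  if h : n + 1 < l then
    A (i ⟨n, Nat.lt_of_succ_lt h⟩, i ⟨n + 1, h⟩) (j ⟨n, Nat.lt_of_succ_lt h⟩, j ⟨n + 1, h⟩) *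
      ∏ m : Fin l, (if m.val = n ∨ m.val = n + 1 then 1 else if i m = j m then 1 else 0)
  else 0

/-- Extension of an operator on `(ℂ^D)^{⊗ l}` to `(ℂ^D)^{⊗ (l+1)}`, acting as the
identity on the last tensor factor. -/
def extendLast (D l : ℕ) (A : Matrix (Fin l → Fin D) (Fin l → Fin D) ℂ) :
    Matrix (Fin (l + 1) → Fin D) (Fin (l + 1) → Fin D) ℂ := fun i j =>
  A (fun m => i m.castSucc) (fun m => j m.castSucc) *
    (if i (Fin.last l) = j (Fin.last l) then 1 else 0)

/-- Extension of an operator on `(ℂ^D)^{⊗ l}` to `(ℂ^D)^{⊗ (l+1)}`, acting as the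
identity on the first tensor factor. -/
def extendFirst (D l : ℕ) (A : Matrix (Fin l → Fin D) (Fin l → Fin D) ℂ) :
    Matrix (Fin (l + 1) → Fin D) (Fin (l + 1) → Fin D) ℂ := fun i j =>
  A (fun m => i m.succ) (fun m => j m.succ) * (if i 0 = j 0 then 1 else 0)

/-- The matrix `M(l+1) = (1/(l+1)) [1 + l·𝖯 − (2Dl/(D+2l−2))·𝒫ᵗ]`. -/
def MStep (D l : ℕ) : PairMat D :=
  ((l : ℂ) + 1)⁻¹ •
    ((1 : PairMat D) + (l : ℂ) • flipMat D -
      (2 * (D : ℂ) * (l : ℂ) / ((D : ℂ) + 2 * (l : ℂ) - 2)) • traceMat D)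

/-- The completely symmetric trace-free projector `𝒫^l` on `(ℂ^D)^{⊗ l}`, defined
recursively by `𝒫^1 = id`, `𝒫^{l+1} = 𝒫^l_{1…l} M(l+1)_{l(l+1)} 𝒫^l_{1…l}`. -/
def symProj (D : ℕ) : (l : ℕ) → Matrix (Fin l → Fin D) (Fin l → Fin D) ℂ
  | 0 => 1
  | 1 => 1
  | (l + 2) =>
      extendLast D (l + 1) (symProj D (l + 1)) * embAt D (l + 2) l (MStep D (l + 1)) *
        extendLast D (l + 1) (symProj D (l + 1))

end Fuzzy

namespace Fuzzy

/-- Brauer relations for `K` generators. -/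
structure Brauer {A : Type*} [Ring A] [Algebra ℂ A] (d : ℂ) (K : ℕ) (s e : ℕ → A) : Prop where
  ss : ∀ i < K, s i * s i = 1
  ee : ∀ i < K, e i * e i = d • e i
  se : ∀ i < K, s i * e i = e i
  es : ∀ i < K, e i * s i = e i
  braid : ∀ i < K, ∀ j < K, (i = j + 1 ∨ j = i + 1) → s i * s j * s i = s j * s i * s j
  eee : ∀ i < K, ∀ j < K, (i = j + 1 ∨ j = i + 1) → e i * e j * e i = e i
  ese : ∀ i < K, ∀ j < K, (i = j + 1 ∨ j = i + 1) → e i * s j * e i = e i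
  ess : ∀ i < K, ∀ j < K, (i = j + 1 ∨ j = i + 1) → e i * s j * s i = e i * e j
  ees : ∀ i < K, ∀ j < K, (i = j + 1 ∨ j = i + 1) → e i * e j * s i = e i * s j
  sse : ∀ i < K, ∀ j < K, (i = j + 1 ∨ j = i + 1) → s i * s j * e i = e j * e i
  see : ∀ i < K, ∀ j < K, (i = j + 1 ∨ j = i + 1) → s i * e j * e i = s j * e i
  ses : ∀ i < K, ∀ j < K, (i = j + 1 ∨ j = i + 1) → s i * e j * s i = s j * e i * s j
  css : ∀ i < K, ∀ j < K, i + 1 < j → s i * s j = s j * s i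
  cse : ∀ i < K, ∀ j < K, i + 1 < j → s i * e j = e j * s i
  ces : ∀ i < K, ∀ j < K, i + 1 < j → e i * s j = s j * e i
  cee : ∀ i < K, ∀ j < K, i + 1 < j → e i * e j = e j * e i

/-- Abstract step. -/
def gM {A : Type*} [Ring A] [Algebra ℂ A] (d : ℂ) (k : ℕ) (s e : A) : A :=
  ((k : ℂ) + 1 + 1)⁻¹ • (1 + ((k : ℂ) + 1) • s - (2 * ((k : ℂ) + 1) / (d + 2 * ((k : ℂ) + 1) - 2)) • e)

/-- Abstract recursion. -/
def Pr {A : Type*} [Ring A] [Algebra ℂ A] (d : ℂ) (s e : ℕ → A) : ℕ → A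
  | 0 => 1
  | k + 1 => Pr d s e k * gM d k (s k) (e k) * Pr d s e k

section
variable {A : Type*} [Ring A] [Algebra ℂ A]

theorem step_lemma (d x y z L c : ℂ) (p a b e f P : A)
    (hP : P = p * (x • 1 + y • a + z • e) * p) (hpP : p * P = P) (hPP : P * P = P)
    (haP : a * P = P) (heP : e * P = 0)
    (hpb : p * b = b * p) (hpf : p * f = f * p)
    (hbb : b * b = 1) (hff : f * f = d • f) (hbf : b * f = f) (hfb : f * b = f)
    (hbab : b * a * b = a * b * a) (hfaf : f * a * f = f) (hfef : f * e * f = f)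
    (hfab : f * a * b = f * e) (hfeb : f * e * b = f * a) (hbeb : b * e * b = a * f * a)
    (heba : e * b * a = e * f) (hbaf : b * a * f = e * f) (hbef : b * e * f = a * f)
    (hx : L * x = 1) (hz : L * z = c * (z - y))
    (hk : 1 + L * (x + z) - c * (x * d + y + z) = 0) :
    b * (P * (1 + L • b - c • f) * P) = P * (1 + L • b - c • f) * P ∧
    f * (P * (1 + L • b - c • f) * P) = 0 := by
  -- P * w = p * (..) * w when p w = w
  have key : ∀ w : A, p * w = w → P * w = x • (p * w) + y • (p * a * w) + z • (p * e * w) := by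
    intro w hw
    rw [hP]
    simp only [mul_add, add_mul, mul_smul_comm, smul_mul_assoc, mul_one, mul_assoc, hw]
  have pb : p * (b * P) = b * P := by rw [← mul_assoc, hpb, mul_assoc, hpP]
  have pf : p * (f * P) = f * P := by rw [← mul_assoc, hpf, mul_assoc, hpP]
  have ebP : e * (b * P) = e * (f * P) := by
    conv_lhs => rw [← haP]
    rw [← mul_assoc, ← mul_assoc, heba, mul_assoc]
  have I1 : P * b * P = x • (b * P) + y • (p * (a * (b * P))) + z • (p * (e * (f * P))) := by
    rw [mul_assoc, key _ pb, pb, mul_assoc, mul_assoc, ebP]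
  have I3 : P * f * P = x • (f * P) + y • (p * (a * (f * P))) + z • (p * (e * (f * P))) := by
    rw [mul_assoc, key _ pf, pf, mul_assoc, mul_assoc]
  have bp : ∀ w, b * (p * w) = p * (b * w) := fun w => by rw [← mul_assoc, ← hpb, mul_assoc]
  have fp : ∀ w, f * (p * w) = p * (f * w) := fun w => by rw [← mul_assoc, ← hpf, mul_assoc]
  have r1 : b * (b * P) = P := by rw [← mul_assoc, hbb, one_mul]
  have r2 : b * (a * (b * P)) = a * (b * P) := by
    rw [← mul_assoc, ← mul_assoc, hbab, mul_assoc, mul_assoc, haP]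
  have r3 : b * (e * (b * P)) = a * (f * P) := by
    rw [← mul_assoc, ← mul_assoc, hbeb, mul_assoc, mul_assoc, haP]
  have r4 : b * (f * P) = f * P := by rw [← mul_assoc, hbf]
  have r5 : b * (a * (f * P)) = e * (f * P) := by rw [← mul_assoc, ← mul_assoc, hbaf, mul_assoc]
  have r6 : b * (e * (f * P)) = a * (f * P) := by rw [← mul_assoc, ← mul_assoc, hbef, mul_assoc]
  have r7 : f * (b * P) = f * P := by rw [← mul_assoc, hfb]
  have r8 : f * (a * (b * P)) = 0 := by rw [← mul_assoc, ← mul_assoc, hfab, mul_assoc, heP, mul_zero]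
  have r9 : f * (e * (b * P)) = f * P := by rw [← mul_assoc, ← mul_assoc, hfeb, mul_assoc, haP]
  have r10 : f * (f * P) = d • (f * P) := by rw [← mul_assoc, hff, smul_mul_assoc]
  have r11 : f * (a * (f * P)) = f * P := by rw [← mul_assoc, ← mul_assoc, hfaf]
  have r12 : f * (e * (f * P)) = f * P := by rw [← mul_assoc, ← mul_assoc, hfef]
  have T : P * (1 + L • b - c • f) * P = P + L • (P * b * P) - c • (P * f * P) := by
    simp only [mul_add, add_mul, mul_sub, sub_mul, mul_smul_comm, smul_mul_assoc, mul_one, hPP]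
  rw [T, I1, I3]
  constructor
  · simp only [mul_add, mul_sub, mul_smul_comm, bp, r1, r2, r4, r5, r6]
    match_scalars <;> first | ring1 | linear_combination hx | linear_combination (-1 : ℂ) * hx | linear_combination hz | linear_combination (-1 : ℂ) * hz
  · simp only [mul_add, mul_sub, mul_smul_comm, fp, r7, r8, r10, r11, r12, pf, mul_zero]
    match_scalars; linear_combination hk

theorem gM_fix (d : ℂ) (k : ℕ) (s e X : A) (h1 : s * X = X) (h2 : e * X = 0) :
    gM d k s e * X = X := by
  have : (k : ℂ) + 1 + 1 ≠ 0 := by exact_mod_cast Nat.succ_ne_zero (k + 1)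
  simp only [gM, smul_mul_assoc, sub_mul, add_mul, h1, h2, one_mul, smul_zero, sub_zero]
  match_scalars
  field_simp
  ring

theorem Pr_fix (d : ℂ) (s e : ℕ → A) (k : ℕ) (X : A) (h1 : ∀ n < k, s n * X = X)
    (h2 : ∀ n < k, e n * X = 0) : Pr d s e k * X = X := by
  induction k with
  | zero => simp [Pr]
  | succ k ih =>
    have := ih (fun n hn => h1 n (by omega)) (fun n hn => h2 n (by omega))
    rw [Pr, mul_assoc, this, mul_assoc, gM_fix _ _ _ _ _ (h1 k (by omega)) (h2 k (by omega)), this]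

theorem Pr_comm (d : ℂ) (s e : ℕ → A) (k : ℕ) (Y : A) (h1 : ∀ n < k, s n * Y = Y * s n)
    (h2 : ∀ n < k, e n * Y = Y * e n) : Pr d s e k * Y = Y * Pr d s e k := by
  induction k with
  | zero => simp [Pr]
  | succ k ih =>
    have := ih (fun n hn => h1 n (by omega)) (fun n hn => h2 n (by omega))
    have hM : gM d k (s k) (e k) * Y = Y * gM d k (s k) (e k) := by
      simp only [gM, smul_mul_assoc, sub_mul, add_mul, mul_smul_comm, mul_sub, mul_add,
        h1 k (by omega), h2 k (by omega), one_mul, mul_one]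
    change Commute _ _ at this
    change Commute _ _ at hM
    exact (this.mul_left hM).mul_left this

theorem Pr_congr (d : ℂ) (s e s' e' : ℕ → A) (k : ℕ) (h1 : ∀ n < k, s n = s' n)
    (h2 : ∀ n < k, e n = e' n) : Pr d s e k = Pr d s' e' k := by
  induction k with
  | zero => simp [Pr]
  | succ k ih =>
    rw [Pr, Pr, ih (fun n hn => h1 n (by omega)) (fun n hn => h2 n (by omega)),
      h1 k (by omega), h2 k (by omega)]

theorem Pr_map {B : Type*} [Ring B] [Algebra ℂ B] (φ : A →ₐ[ℂ] B) (d : ℂ) (s e : ℕ → A) (k : ℕ) :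
    φ (Pr d s e k) = Pr d (fun n => φ (s n)) (fun n => φ (e n)) k := by
  induction k with
  | zero => simp [Pr]
  | succ k ih => simp [Pr, ih, gM]

theorem scal1 (m d : ℂ) (e2 : m + 1 + 1 ≠ 0) (e3 : d + 2 * (m + 1) - 2 ≠ 0)
    (e4 : d + 2 * (m + 1 + 1) - 2 ≠ 0) :
    (m + 1 + 1) * (- ((m + 1 + 1)⁻¹ * (2 * (m + 1) / (d + 2 * (m + 1) - 2)))) =
      (2 * (m + 1 + 1) / (d + 2 * (m + 1 + 1) - 2)) *
      ((- ((m + 1 + 1)⁻¹ * (2 * (m + 1) / (d + 2 * (m + 1) - 2)))) - (m + 1 + 1)⁻¹ * (m + 1)) := by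
  obtain ⟨t, rfl⟩ : ∃ t, d = t - 2 * m := ⟨d + 2 * m, by ring⟩
  have q3 : t - 2 * m + 2 * (m + 1) - 2 = t := by ring
  have q4 : t - 2 * m + 2 * (m + 1 + 1) - 2 = t + 2 := by ring
  rw [q3] at e3
  rw [q4] at e4
  rw [q3, q4]
  field_simp
  ring

theorem scal2 (m d : ℂ) (e2 : m + 1 + 1 ≠ 0) (e3 : d + 2 * (m + 1) - 2 ≠ 0)
    (e4 : d + 2 * (m + 1 + 1) - 2 ≠ 0) :
    1 + (m + 1 + 1) * ((m + 1 + 1)⁻¹ + (- ((m + 1 + 1)⁻¹ * (2 * (m + 1) / (d + 2 * (m + 1) - 2))))) -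
      (2 * (m + 1 + 1) / (d + 2 * (m + 1 + 1) - 2)) *
      ((m + 1 + 1)⁻¹ * d + (m + 1 + 1)⁻¹ * (m + 1) +
        (- ((m + 1 + 1)⁻¹ * (2 * (m + 1) / (d + 2 * (m + 1) - 2))))) = 0 := by
  obtain ⟨t, rfl⟩ : ∃ t, d = t - 2 * m := ⟨d + 2 * m, by ring⟩
  have q3 : t - 2 * m + 2 * (m + 1) - 2 = t := by ring
  have q4 : t - 2 * m + 2 * (m + 1 + 1) - 2 = t + 2 := by ring
  rw [q3] at e3
  rw [q4] at e4
  rw [q3, q4]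
  field_simp
  ring

theorem Pr_main (D : ℕ) (hD : 2 ≤ D) (K : ℕ) (s e : ℕ → A) (H : Brauer (D : ℂ) K s e) (k : ℕ)
    (hk : k ≤ K) :
    (∀ n < k, s n * Pr (D : ℂ) s e k = Pr D s e k ∧ e n * Pr (D : ℂ) s e k = 0) ∧
    Pr (D : ℂ) s e k * Pr D s e k = Pr D s e k := by
  induction k using Nat.strong_induction_on with
  | _ k0 ih =>
  cases k0 with
  | zero => simp [Pr]
  | succ k =>
    obtain ⟨ih1, ih2⟩ := ih k (by omega) (by omega)
    have main : ∀ n < k + 1, s n * Pr (D : ℂ) s e (k + 1) = Pr D s e (k + 1) ∧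
        e n * Pr (D : ℂ) s e (k + 1) = 0 := by
      intro n hn
      by_cases hnk : n < k
      · rw [Pr, mul_assoc, ← mul_assoc, ← mul_assoc (e n), (ih1 n hnk).1, (ih1 n hnk).2]
        simp
      · obtain rfl : n = k := by omega
        have hD0 : (D : ℂ) ≠ 0 := by
          have : D ≠ 0 := by omega
          exact_mod_cast this
        cases n with
        | zero =>
          simp only [Pr, gM, mul_one, one_mul, mul_smul_comm, mul_sub, mul_add,
            H.ss 0 (by omega), H.se 0 (by omega), H.es 0 (by omega), H.ee 0 (by omega)]
          constructor
          · match_scalars <;> simp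
          · rw [show ((0 : ℕ) : ℂ) = 0 from Nat.cast_zero]
            match_scalars
            field_simp
            norm_num
            rw [mul_div_assoc, div_self hD0]
            norm_num
        | succ m =>
          have e1 : (m : ℂ) + 1 ≠ 0 := by exact_mod_cast Nat.succ_ne_zero m
          have e2 : (m : ℂ) + 1 + 1 ≠ 0 := by exact_mod_cast Nat.succ_ne_zero (m + 1)
          have e3 : (D : ℂ) + 2 * (m + 1) - 2 ≠ 0 := by
            have : (D : ℂ) + 2 * (m + 1) - 2 = ((D + 2 * m : ℕ) : ℂ) := by push_cast; ring
            rw [this]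
            have : D + 2 * m ≠ 0 := by omega
            exact_mod_cast this
          have e4 : (D : ℂ) + 2 * (m + 1 + 1) - 2 ≠ 0 := by
            have : (D : ℂ) + 2 * (m + 1 + 1) - 2 = ((D + 2 * m + 2 : ℕ) : ℂ) := by push_cast; ring
            rw [this]
            have : D + 2 * m + 2 ≠ 0 := by omega
            exact_mod_cast this
          have i1 : m < K := by omega
          have i2 : m + 1 < K := by omega
          have pp := (ih m (by omega) (by omega)).2
          have step := step_lemma (D : ℂ) (((m : ℂ) + 1 + 1)⁻¹) (((m : ℂ) + 1 + 1)⁻¹ * (m + 1))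
            (- (((m : ℂ) + 1 + 1)⁻¹ * (2 * ((m : ℂ) + 1) / (D + 2 * ((m : ℂ) + 1) - 2))))
            ((m : ℂ) + 1 + 1)
            (2 * ((m : ℂ) + 1 + 1) / (D + 2 * ((m : ℂ) + 1 + 1) - 2))
            (Pr D s e m) (s m) (s (m + 1)) (e m) (e (m + 1)) (Pr D s e (m + 1))
            (by
              rw [Pr, gM]
              congr 2
              module)
            (by rw [Pr, ← mul_assoc, ← mul_assoc, pp])
            ih2 (ih1 m (by omega)).1 (ih1 m (by omega)).2
            (Pr_comm _ _ _ _ _ (fun n hn => H.css _ (by omega) _ i2 (by omega))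
              (fun n hn => H.ces _ (by omega) _ i2 (by omega)))
            (Pr_comm _ _ _ _ _ (fun n hn => H.cse _ (by omega) _ i2 (by omega))
              (fun n hn => H.cee _ (by omega) _ i2 (by omega)))
            (H.ss _ i2) (H.ee _ i2) (H.se _ i2) (H.es _ i2)
            (H.braid _ i2 _ i1 (by omega)) (H.ese _ i2 _ i1 (by omega))
            (H.eee _ i2 _ i1 (by omega)) (H.ess _ i2 _ i1 (by omega))
            (H.ees _ i2 _ i1 (by omega)) (H.ses _ i2 _ i1 (by omega))
            (H.ess _ i1 _ i2 (by omega)) (H.sse _ i2 _ i1 (by omega))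
            (H.see _ i2 _ i1 (by omega))
            (by field_simp) (scal1 _ _ e2 e3 e4) (scal2 _ _ e2 e3 e4)
          have hPr : Pr (D : ℂ) s e (m + 1 + 1) = ((m : ℂ) + 1 + 1 + 1)⁻¹ •
              (Pr D s e (m + 1) * (1 + ((m : ℂ) + 1 + 1) • s (m + 1) -
                (2 * ((m : ℂ) + 1 + 1) / (D + 2 * ((m : ℂ) + 1 + 1) - 2)) • e (m + 1)) *
                Pr D s e (m + 1)) := by
            conv_lhs => rw [Pr, gM]
            rw [mul_smul_comm, smul_mul_assoc]
            push_cast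
            rfl
          rw [hPr, mul_smul_comm, mul_smul_comm, step.1, step.2, smul_zero]
          exact ⟨rfl, rfl⟩
    refine ⟨main, ?_⟩
    have h1 := Pr_fix (D : ℂ) s e (k + 1) (Pr (D : ℂ) s e (k + 1)) (fun n hn => (main n hn).1)
      (fun n hn => (main n hn).2)
    exact h1

end
end Fuzzy

namespace Fuzzy

section ops
variable {ι : Type*} [DecidableEq ι] {D : ℕ}

/-- Permutation operator. -/
def Sop (D : ℕ) (σ : Equiv.Perm ι) : Module.End ℂ ((ι → Fin D) → ℂ) where
  toFun v i := v (i ∘ σ)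
  map_add' _ _ := rfl
  map_smul' _ _ := rfl

/-- Contraction operator. -/
def Eop (D : ℕ) (p q : ι) : Module.End ℂ ((ι → Fin D) → ℂ) where
  toFun v i := if i p = i q then ∑ x, v (Function.update (Function.update i p x) q x) else 0
  map_add' v w := by
    ext i
    by_cases h : i p = i q <;> simp [h, Finset.sum_add_distrib]
  map_smul' c w := by
    ext i
    by_cases h : i p = i q <;> simp [h, Finset.mul_sum]

theorem Sop_apply (σ : Equiv.Perm ι) (v : (ι → Fin D) → ℂ) (i : ι → Fin D) :
    Sop D σ v i = v (i ∘ σ) := rfl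

theorem Eop_apply (p q : ι) (v : (ι → Fin D) → ℂ) (i : ι → Fin D) :
    Eop D p q v i = if i p = i q then
      ∑ x, v (Function.update (Function.update i p x) q x) else 0 := rfl

theorem Sop_mul (σ τ : Equiv.Perm ι) : Sop D σ * Sop D τ = Sop D (σ * τ) := rfl

theorem Sop_one : Sop D (1 : Equiv.Perm ι) = 1 := rfl

theorem Sop_Eop (σ : Equiv.Perm ι) (p q : ι) :
    Sop D σ * Eop D p q = Eop D (σ p) (σ q) * Sop D σ := by
  refine LinearMap.ext fun v => funext fun i => ?_
  simp only [Module.End.mul_apply, Sop_apply, Eop_apply, Function.comp]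
  refine if_congr Iff.rfl (Finset.sum_congr rfl fun x _ => ?_) rfl
  congr 1
  funext m
  simp [Function.update_apply]

theorem Eop_symm {p q : ι} (h : p ≠ q) : Eop D p q = Eop D q p := by
  refine LinearMap.ext fun v => funext fun i => ?_
  simp only [Eop_apply]
  refine if_congr eq_comm (Finset.sum_congr rfl fun x _ => ?_) rfl
  rw [Function.update_comm h]

theorem swap_Eop (p q : ι) : Sop D (Equiv.swap p q) * Eop D p q = Eop D p q := by
  refine LinearMap.ext fun v => funext fun i => ?_
  simp only [Module.End.mul_apply, Sop_apply, Eop_apply, Function.comp, Equiv.swap_apply_left,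
    Equiv.swap_apply_right]
  refine if_congr eq_comm (Finset.sum_congr rfl fun x _ => ?_) rfl
  congr 1
  funext m
  by_cases h1 : m = q
  · simp [h1]
  · by_cases h2 : m = p
    · simp [h2, Function.update_apply]
    · simp [h1, h2, Equiv.swap_apply_of_ne_of_ne h2 h1]

theorem Eop_swap {p q : ι} (h : p ≠ q) : Eop D p q * Sop D (Equiv.swap p q) = Eop D p q := by
  have := Sop_Eop (D := D) (Equiv.swap p q) p q
  rw [swap_Eop, Equiv.swap_apply_left, Equiv.swap_apply_right, ← Eop_symm h] at this
  exact this.symm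

theorem Eop_sq {p q : ι} (h : p ≠ q) : Eop D p q * Eop D p q = (D : ℂ) • Eop D p q := by
  refine LinearMap.ext fun v => funext fun i => ?_
  simp only [Module.End.mul_apply, Eop_apply, LinearMap.smul_apply, Pi.smul_apply, smul_eq_mul]
  by_cases hi : i p = i q
  · simp only [hi, if_true]
    have : ∀ x y : Fin D, Function.update (Function.update (Function.update (Function.update i p x) q x) p y) q y
        = Function.update (Function.update i p y) q y := by
      intro x y
      funext m
      simp only [Function.update_apply]
      split_ifs <;> rfl
    simp [this, Function.update_apply, h]
  · simp [hi]

theorem Eop_Eop {p q r : ι} (hpq : p ≠ q) (hpr : p ≠ r) (hqr : q ≠ r) :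
    Eop D p q * Eop D q r = Eop D p q * Sop D (Equiv.swap p r) := by
  refine LinearMap.ext fun v => funext fun i => ?_
  simp only [Module.End.mul_apply, Eop_apply, Sop_apply]
  refine if_congr Iff.rfl ?_ rfl
  have : ∀ x : Fin D, (Function.update (Function.update i p x) q x q =
      Function.update (Function.update i p x) q x r) ↔ x = i r := by
    intro x
    simp [Function.update_apply, hpr.symm, hqr.symm]
  simp only [this, Finset.sum_ite_eq', Finset.mem_univ, if_true]
  refine Finset.sum_congr rfl fun x _ => ?_
  congr 1
  funext m
  by_cases h1 : m = p
  · subst h1; simp [Function.update_apply, hpq, hpr, hqr.symm, hpr.symm]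
  · by_cases h2 : m = r
    · subst h2; simp [Function.update_apply, hpq]
    · simp only [Function.comp, Equiv.swap_apply_of_ne_of_ne h1 h2, Function.update_apply, h1, h2, if_false]
      split_ifs <;> rfl

theorem Eop_comm {p q r t : ι} (hpr : p ≠ r) (hpt : p ≠ t)
    (hqr : q ≠ r) (hqt : q ≠ t) :
    Eop D p q * Eop D r t = Eop D r t * Eop D p q := by
  refine LinearMap.ext fun v => funext fun i => ?_
  simp only [Module.End.mul_apply, Eop_apply]
  simp only [Function.update_apply, hpr, hpt, hqr, hqt, hpr.symm, hpt.symm, hqr.symm, hqt.symm,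
    if_false]
  by_cases h1 : i p = i q <;> by_cases h2 : i r = i t <;> simp only [h1, h2, if_true, if_false,
    Finset.sum_const_zero]
  rw [Finset.sum_comm]
  refine Finset.sum_congr rfl fun x _ => Finset.sum_congr rfl fun y _ => ?_
  congr 1
  funext m
  simp only [Function.update_apply]
  split_ifs <;> simp_all

theorem Sop_swap_sq (p q : ι) : Sop D (Equiv.swap p q) * Sop D (Equiv.swap p q) = 1 := by
  rw [Sop_mul, Equiv.swap_mul_self, Sop_one]

theorem ese_aux {p q r : ι} (hpq : p ≠ q) (hpr : p ≠ r) (hqr : q ≠ r) :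
    Eop D p q * Sop D (Equiv.swap q r) * Eop D p q = Eop D p q := by
  rw [mul_assoc, Sop_Eop, Equiv.swap_apply_left, Equiv.swap_apply_of_ne_of_ne hpq hpr,
    ← mul_assoc, Eop_symm hpq, Eop_Eop hpq.symm hqr hpr, mul_assoc, Sop_swap_sq, mul_one]

theorem ess_aux {p q r : ι} (hpq : p ≠ q) (hpr : p ≠ r) (hqr : q ≠ r) :
    Eop D p q * Sop D (Equiv.swap q r) * Sop D (Equiv.swap p q) = Eop D p q * Eop D q r := by
  have : Equiv.swap p r = Equiv.swap p q * Equiv.swap q r * Equiv.swap p q := by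
    rw [Equiv.swap_comm p q, Equiv.swap_comm q r, Equiv.swap_mul_swap_mul_swap hqr.symm hpr.symm]
  rw [Eop_Eop hpq hpr hqr, this, ← Sop_mul, ← Sop_mul, ← mul_assoc, ← mul_assoc, Eop_swap hpq]

theorem adj_rel {p q r : ι} (hpq : p ≠ q) (hpr : p ≠ r) (hqr : q ≠ r)
    (a b e f : Module.End ℂ ((ι → Fin D) → ℂ))
    (ha : a = Sop D (Equiv.swap p q)) (hb : b = Sop D (Equiv.swap q r))
    (he : e = Eop D p q) (hf : f = Eop D q r) :
    a * b * a = b * a * b ∧ e * f * e = e ∧ e * b * e = e ∧ e * b * a = e * f ∧ e * f * a = e * b ∧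
    a * b * e = f * e ∧ a * f * e = b * e ∧ a * f * a = b * e * b := by
  have haa : a * a = 1 := by rw [ha, Sop_swap_sq]
  have hbb : b * b = 1 := by rw [hb, Sop_swap_sq]
  have hess : e * b * a = e * f := by rw [ha, hb, he, hf, ess_aux hpq hpr hqr]
  have hsse : a * b * e = f * e := by
    have h1 : a * b * e = f * a * b := by
      rw [ha, hb, he, hf, mul_assoc, Sop_Eop, ← mul_assoc, Sop_Eop]
      rw [Equiv.swap_apply_left q r, Equiv.swap_apply_of_ne_of_ne hpq hpr, Equiv.swap_apply_left,
        Equiv.swap_apply_of_ne_of_ne hpr.symm hqr.symm]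
    rw [h1, ha, hb, he, hf, Eop_symm hqr, Eop_symm hpq, ← ess_aux hqr.symm hpr.symm hpq.symm,
      Equiv.swap_comm p q, Equiv.swap_comm q r]
  refine ⟨?_, ?_, ?_, hess, ?_, hsse, ?_, ?_⟩
  · rw [ha, hb]
    simp only [Sop_mul]
    rw [Equiv.swap_mul_swap_mul_swap hpq hpr, Equiv.swap_comm p q, Equiv.swap_comm q r,
      Equiv.swap_mul_swap_mul_swap hqr.symm hpr.symm, Equiv.swap_comm]
  · rw [he, hf, Eop_Eop hpq hpr hqr, Eop_symm hpq, ese_aux hpq.symm hqr hpr]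
  · rw [he, hb, ese_aux hpq hpr hqr]
  · rw [← hess, mul_assoc, haa, mul_one]
  · rw [mul_assoc, ← hsse, ← mul_assoc, ← mul_assoc, haa, one_mul]
  · have h1 : a * f = Eop D p r * a := by
      rw [ha, hf, Sop_Eop, Equiv.swap_apply_right, Equiv.swap_apply_of_ne_of_ne hpr.symm hqr.symm]
    have h2 : b * e = Eop D p r * b := by
      rw [hb, he, Sop_Eop, Equiv.swap_apply_left, Equiv.swap_apply_of_ne_of_ne hpq hpr]
    rw [h1, h2, mul_assoc, mul_assoc, haa, hbb]

theorem brauer_ops (N : ℕ) (s e : ℕ → Module.End ℂ ((Fin N → Fin D) → ℂ))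
    (hs : ∀ n (h : n + 1 < N), s n = Sop D (Equiv.swap ⟨n, Nat.lt_of_succ_lt h⟩ ⟨n + 1, h⟩))
    (he : ∀ n (h : n + 1 < N), e n = Eop D ⟨n, Nat.lt_of_succ_lt h⟩ ⟨n + 1, h⟩) :
    Brauer (D : ℂ) (N - 1) s e := by
  have adj : ∀ i < N - 1, ∀ j < N - 1, (i = j + 1 ∨ j = i + 1) →
      s i * s j * s i = s j * s i * s j ∧ e i * e j * e i = e i ∧ e i * s j * e i = e i ∧
      e i * s j * s i = e i * e j ∧ e i * e j * s i = e i * s j ∧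
      s i * s j * e i = e j * e i ∧ s i * e j * e i = s j * e i ∧
      s i * e j * s i = s j * e i * s j := by
    intro i hi j hj hij
    have hi' : i + 1 < N := by omega
    have hj' : j + 1 < N := by omega
    rcases hij with rfl | rfl
    · refine adj_rel (p := ⟨j + 1 + 1, hi'⟩) (q := ⟨j + 1, hj'⟩) (r := ⟨j, Nat.lt_of_succ_lt hj'⟩)
        (by simp) (by simp [Fin.ext_iff]; omega) (by simp) _ _ _ _ ?_ ?_ ?_ ?_
      · rw [hs _ hi', Equiv.swap_comm]
      · rw [hs _ hj', Equiv.swap_comm]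
      · rw [he _ hi', Eop_symm (by simp)]
      · rw [he _ hj', Eop_symm (by simp)]
    · exact adj_rel (p := ⟨i, Nat.lt_of_succ_lt hi'⟩) (q := ⟨i + 1, hi'⟩) (r := ⟨i + 1 + 1, hj'⟩)
        (by simp) (by simp [Fin.ext_iff]; omega) (by simp) _ _ _ _ (hs _ hi') (hs _ hj') (he _ hi') (he _ hj')
  have far : ∀ i < N - 1, ∀ j < N - 1, i + 1 < j → s i * s j = s j * s i ∧ s i * e j = e j * s i ∧
      e i * s j = s j * e i ∧ e i * e j = e j * e i := by
    intro i hi j hj hij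
    have hi' : i + 1 < N := by omega
    have hj' : j + 1 < N := by omega
    have n1 : (⟨i, by omega⟩ : Fin N) ≠ ⟨j, by omega⟩ := by simp; omega
    have n2 : (⟨i, by omega⟩ : Fin N) ≠ ⟨j + 1, hj'⟩ := by simp; omega
    have n3 : (⟨i + 1, hi'⟩ : Fin N) ≠ ⟨j, by omega⟩ := by simp; omega
    have n4 : (⟨i + 1, hi'⟩ : Fin N) ≠ ⟨j + 1, hj'⟩ := by simp; omega
    rw [hs i hi', hs j hj', he i hi', he j hj']
    refine ⟨?_, ?_, ?_, Eop_comm n1 n2 n3 n4⟩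
    · rw [Sop_mul, Sop_mul]
      congr 1
      refine Equiv.Perm.Disjoint.commute ?_
      intro m
      by_cases h1 : m = ⟨i, by omega⟩
      · right; rw [h1]; exact Equiv.swap_apply_of_ne_of_ne n1 n2
      · by_cases h2 : m = ⟨i + 1, hi'⟩
        · right; rw [h2]; exact Equiv.swap_apply_of_ne_of_ne n3 n4
        · left; exact Equiv.swap_apply_of_ne_of_ne h1 h2
    · rw [Sop_Eop, Equiv.swap_apply_of_ne_of_ne n1.symm n3.symm,
        Equiv.swap_apply_of_ne_of_ne n2.symm n4.symm]
    · rw [Sop_Eop, Equiv.swap_apply_of_ne_of_ne n1 n2, Equiv.swap_apply_of_ne_of_ne n3 n4]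
  have ne : ∀ i (h : i + 1 < N), (⟨i, Nat.lt_of_succ_lt h⟩ : Fin N) ≠ ⟨i + 1, h⟩ := by
    intro i h; simp
  exact {
    ss := fun i hi => by rw [hs i (by omega), Sop_swap_sq]
    ee := fun i hi => by rw [he i (by omega), Eop_sq (ne _ _)]
    se := fun i hi => by rw [hs i (by omega), he i (by omega), swap_Eop]
    es := fun i hi => by rw [hs i (by omega), he i (by omega), Eop_swap (ne _ _)]
    braid := fun i hi j hj h => (adj i hi j hj h).1
    eee := fun i hi j hj h => (adj i hi j hj h).2.1
    ese := fun i hi j hj h => (adj i hi j hj h).2.2.1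
    ess := fun i hi j hj h => (adj i hi j hj h).2.2.2.1
    ees := fun i hi j hj h => (adj i hi j hj h).2.2.2.2.1
    sse := fun i hi j hj h => (adj i hi j hj h).2.2.2.2.2.1
    see := fun i hi j hj h => (adj i hi j hj h).2.2.2.2.2.2.1
    ses := fun i hi j hj h => (adj i hi j hj h).2.2.2.2.2.2.2
    css := fun i hi j hj h => (far i hi j hj h).1
    cse := fun i hi j hj h => (far i hi j hj h).2.1
    ces := fun i hi j hj h => (far i hi j hj h).2.2.1
    cee := fun i hi j hj h => (far i hi j hj h).2.2.2 }

end ops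

section transfer
variable {A B : Type*} [Ring A] [Algebra ℂ A] [Ring B] [Algebra ℂ B]

theorem Brauer.of_map (φ : A →ₐ[ℂ] B) (hφ : Function.Injective φ) {d : ℂ} {K : ℕ} {s e : ℕ → A}
    (H : Brauer d K (fun n => φ (s n)) (fun n => φ (e n))) : Brauer d K s e where
  ss i hi := hφ (by simpa using H.ss i hi)
  ee i hi := hφ (by simpa using H.ee i hi)
  se i hi := hφ (by simpa using H.se i hi)
  es i hi := hφ (by simpa using H.es i hi)
  braid i hi j hj h := hφ (by simpa using H.braid i hi j hj h)
  eee i hi j hj h := hφ (by simpa using H.eee i hi j hj h)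
  ese i hi j hj h := hφ (by simpa using H.ese i hi j hj h)
  ess i hi j hj h := hφ (by simpa using H.ess i hi j hj h)
  ees i hi j hj h := hφ (by simpa using H.ees i hi j hj h)
  sse i hi j hj h := hφ (by simpa using H.sse i hi j hj h)
  see i hi j hj h := hφ (by simpa using H.see i hi j hj h)
  ses i hi j hj h := hφ (by simpa using H.ses i hi j hj h)
  css i hi j hj h := hφ (by simpa using H.css i hi j hj h)
  cse i hi j hj h := hφ (by simpa using H.cse i hi j hj h)
  ces i hi j hj h := hφ (by simpa using H.ces i hi j hj h)
  cee i hi j hj h := hφ (by simpa using H.cee i hi j hj h)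

theorem Brauer.rev {d : ℂ} {K : ℕ} {s e : ℕ → A} (H : Brauer d K s e) :
    Brauer d K (fun n => s (K - 1 - n)) (fun n => e (K - 1 - n)) where
  ss i hi := H.ss _ (by omega)
  ee i hi := H.ee _ (by omega)
  se i hi := H.se _ (by omega)
  es i hi := H.es _ (by omega)
  braid i hi j hj h := H.braid _ (by omega) _ (by omega) (by omega)
  eee i hi j hj h := H.eee _ (by omega) _ (by omega) (by omega)
  ese i hi j hj h := H.ese _ (by omega) _ (by omega) (by omega)
  ess i hi j hj h := H.ess _ (by omega) _ (by omega) (by omega)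
  ees i hi j hj h := H.ees _ (by omega) _ (by omega) (by omega)
  sse i hi j hj h := H.sse _ (by omega) _ (by omega) (by omega)
  see i hi j hj h := H.see _ (by omega) _ (by omega) (by omega)
  ses i hi j hj h := H.ses _ (by omega) _ (by omega) (by omega)
  css i hi j hj h := (H.css _ (by omega) _ (by omega) (by omega)).symm
  cse i hi j hj h := (H.ces _ (by omega) _ (by omega) (by omega)).symm
  ces i hi j hj h := (H.cse _ (by omega) _ (by omega) (by omega)).symm
  cee i hi j hj h := (H.cee _ (by omega) _ (by omega) (by omega)).symm

theorem Brauer.shift {d : ℂ} {K : ℕ} {s e : ℕ → A} (H : Brauer d (K + 1) s e) :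
    Brauer d K (fun n => s (n + 1)) (fun n => e (n + 1)) where
  ss i hi := H.ss _ (by omega)
  ee i hi := H.ee _ (by omega)
  se i hi := H.se _ (by omega)
  es i hi := H.es _ (by omega)
  braid i hi j hj h := H.braid _ (by omega) _ (by omega) (by omega)
  eee i hi j hj h := H.eee _ (by omega) _ (by omega) (by omega)
  ese i hi j hj h := H.ese _ (by omega) _ (by omega) (by omega)
  ess i hi j hj h := H.ess _ (by omega) _ (by omega) (by omega)
  ees i hi j hj h := H.ees _ (by omega) _ (by omega) (by omega)
  sse i hi j hj h := H.sse _ (by omega) _ (by omega) (by omega)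
  see i hi j hj h := H.see _ (by omega) _ (by omega) (by omega)
  ses i hi j hj h := H.ses _ (by omega) _ (by omega) (by omega)
  css i hi j hj h := H.css _ (by omega) _ (by omega) (by omega)
  cse i hi j hj h := H.cse _ (by omega) _ (by omega) (by omega)
  ces i hi j hj h := H.ces _ (by omega) _ (by omega) (by omega)
  cee i hi j hj h := H.cee _ (by omega) _ (by omega) (by omega)

theorem Brauer.mono {d : ℂ} {K K' : ℕ} {s e : ℕ → A} (H : Brauer d K' s e) (hK : K ≤ K') :
    Brauer d K s e where
  ss i hi := H.ss _ (by omega)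
  ee i hi := H.ee _ (by omega)
  se i hi := H.se _ (by omega)
  es i hi := H.es _ (by omega)
  braid i hi j hj h := H.braid _ (by omega) _ (by omega) (by omega)
  eee i hi j hj h := H.eee _ (by omega) _ (by omega) (by omega)
  ese i hi j hj h := H.ese _ (by omega) _ (by omega) (by omega)
  ess i hi j hj h := H.ess _ (by omega) _ (by omega) (by omega)
  ees i hi j hj h := H.ees _ (by omega) _ (by omega) (by omega)
  sse i hi j hj h := H.sse _ (by omega) _ (by omega) (by omega)
  see i hi j hj h := H.see _ (by omega) _ (by omega) (by omega)
  ses i hi j hj h := H.ses _ (by omega) _ (by omega) (by omega)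
  css i hi j hj h := H.css _ (by omega) _ (by omega) (by omega)
  cse i hi j hj h := H.cse _ (by omega) _ (by omega) (by omega)
  ces i hi j hj h := H.ces _ (by omega) _ (by omega) (by omega)
  cee i hi j hj h := H.cee _ (by omega) _ (by omega) (by omega)

end transfer
end Fuzzy

namespace Fuzzy

section mats
variable {D : ℕ}

theorem embAt_eq (N n : ℕ) (h : n + 1 < N) (A : PairMat D) (i j : Fin N → Fin D) :
    embAt D N n A i j = if (∀ m : Fin N, (m.val = n ∨ m.val = n + 1) ∨ i m = j m) then
      A (i ⟨n, Nat.lt_of_succ_lt h⟩, i ⟨n + 1, h⟩) (j ⟨n, Nat.lt_of_succ_lt h⟩, j ⟨n + 1, h⟩)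
      else 0 := by
  have : ∀ m : Fin N, (if m.val = n ∨ m.val = n + 1 then (1 : ℂ) else if i m = j m then 1 else 0) =
      if ((m.val = n ∨ m.val = n + 1) ∨ i m = j m) then 1 else 0 := by
    intro m
    by_cases h1 : m.val = n ∨ m.val = n + 1 <;> simp [h1]
  rw [embAt, dif_pos h]
  simp only [this]
  rw [Finset.prod_boole]
  simp

theorem embAt_add (N n : ℕ) (A B : PairMat D) :
    embAt D N n (A + B) = embAt D N n A + embAt D N n B := by
  ext i j
  by_cases h : n + 1 < N <;> simp [embAt, h, add_mul]

theorem embAt_smul (N n : ℕ) (c : ℂ) (A : PairMat D) :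
    embAt D N n (c • A) = c • embAt D N n A := by
  ext i j
  by_cases h : n + 1 < N <;> simp [embAt, h, mul_assoc]

theorem embAt_sub (N n : ℕ) (A B : PairMat D) :
    embAt D N n (A - B) = embAt D N n A - embAt D N n B := by
  ext i j
  by_cases h : n + 1 < N <;> simp [embAt, h, sub_mul]

theorem embAt_one (N n : ℕ) (h : n + 1 < N) : embAt D N n 1 = 1 := by
  ext i j
  rw [embAt_eq _ _ h, Matrix.one_apply, Matrix.one_apply, ← ite_and]
  refine if_congr ?_ rfl rfl
  constructor
  · rintro ⟨h1, h2⟩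
    rw [Prod.mk.injEq] at h2
    funext m
    rcases h1 m with (h3 | h3) | h3
    · convert h2.1
    · convert h2.2
    · exact h3
  · rintro rfl
    simp

theorem embAt_transpose (N n : ℕ) (A : PairMat D) (hA : A.transpose = A) :
    (embAt D N n A).transpose = embAt D N n A := by
  ext i j
  rw [Matrix.transpose_apply]
  by_cases h : n + 1 < N
  · rw [embAt_eq _ _ h, embAt_eq _ _ h]
    refine if_congr ?_ ?_ rfl
    · simp only [eq_comm]
    · conv_lhs => rw [← hA, Matrix.transpose_apply]
  · simp [embAt, h]

theorem flip_transpose : (flipMat D).transpose = flipMat D := by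
  ext i j
  simp only [Matrix.transpose_apply, flipMat]
  refine if_congr ?_ rfl rfl
  constructor <;> rintro ⟨h1, h2⟩ <;> exact ⟨h2.symm, h1.symm⟩

theorem trace_transpose : (traceMat D).transpose = traceMat D := by
  ext i j
  simp only [Matrix.transpose_apply, traceMat]
  ring

/-- The flips. -/
def sM (D N : ℕ) (n : ℕ) : Matrix (Fin N → Fin D) (Fin N → Fin D) ℂ := embAt D N n (flipMat D)

/-- The contractions. -/
def eM (D N : ℕ) (n : ℕ) : Matrix (Fin N → Fin D) (Fin N → Fin D) ℂ :=
  (D : ℂ) • embAt D N n (traceMat D)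

theorem sM_toLin (N n : ℕ) (h : n + 1 < N) : Matrix.toLinAlgEquiv' (sM D N n) =
    Sop D (Equiv.swap ⟨n, Nat.lt_of_succ_lt h⟩ ⟨n + 1, h⟩) := by
  refine LinearMap.ext fun v => funext fun i => ?_
  rw [Matrix.toLinAlgEquiv'_apply, Sop_apply, Matrix.mulVec, dotProduct]
  have : ∀ j, sM D N n i j =
      if i ∘ Equiv.swap ⟨n, Nat.lt_of_succ_lt h⟩ ⟨n + 1, h⟩ = j then 1 else 0 := by
    intro j
    rw [sM, embAt_eq _ _ h, flipMat, ← ite_and]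
    refine if_congr ?_ rfl rfl
    constructor
    · rintro ⟨h1, h2, h3⟩
      funext m
      rcases h1 m with (h4 | h4) | h4
      · obtain rfl : m = ⟨n, Nat.lt_of_succ_lt h⟩ := Fin.ext h4
        simpa using h3
      · obtain rfl : m = ⟨n + 1, h⟩ := Fin.ext h4
        simpa using h2
      · by_cases h5 : m = ⟨n, Nat.lt_of_succ_lt h⟩
        · subst h5; simpa using h3
        · by_cases h6 : m = ⟨n + 1, h⟩
          · subst h6; simpa using h2
          · simpa [Equiv.swap_apply_of_ne_of_ne h5 h6] using h4
    · rintro rfl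
      refine ⟨fun m => ?_, by simp, by simp⟩
      by_cases h5 : m = ⟨n, Nat.lt_of_succ_lt h⟩
      · left; left; rw [h5]
      · by_cases h6 : m = ⟨n + 1, h⟩
        · left; right; rw [h6]
        · right; simp [Equiv.swap_apply_of_ne_of_ne h5 h6]
  simp [this]

theorem eM_toLin (hD : (D : ℂ) ≠ 0) (N n : ℕ) (h : n + 1 < N) :
    Matrix.toLinAlgEquiv' (eM D N n) =
    Eop D ⟨n, Nat.lt_of_succ_lt h⟩ ⟨n + 1, h⟩ := by
  refine LinearMap.ext fun v => funext fun i => ?_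
  rw [Matrix.toLinAlgEquiv'_apply, Eop_apply, Matrix.mulVec, dotProduct]
  have hne : (⟨n, Nat.lt_of_succ_lt h⟩ : Fin N) ≠ ⟨n + 1, h⟩ := by simp
  have : ∀ j, eM D N n i j = if i ⟨n, Nat.lt_of_succ_lt h⟩ = i ⟨n + 1, h⟩ then
      ∑ x, if Function.update (Function.update i ⟨n, Nat.lt_of_succ_lt h⟩ x) ⟨n + 1, h⟩ x = j
        then 1 else 0 else 0 := by
    intro j
    rw [eM, Matrix.smul_apply, embAt_eq _ _ h, traceMat]
    by_cases h1 : i ⟨n, Nat.lt_of_succ_lt h⟩ = i ⟨n + 1, h⟩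
    · simp only [h1, if_true]
      have e1 : ∀ x, (Function.update (Function.update i ⟨n, Nat.lt_of_succ_lt h⟩ x) ⟨n + 1, h⟩ x = j)
          ↔ (x = j ⟨n, Nat.lt_of_succ_lt h⟩ ∧ (j ⟨n, Nat.lt_of_succ_lt h⟩ = j ⟨n + 1, h⟩ ∧
            ∀ m : Fin N, (m.val = n ∨ m.val = n + 1) ∨ i m = j m)) := by
        intro x
        constructor
        · rintro rfl
          refine ⟨by simp [hne], by simp [hne], fun m => ?_⟩
          by_cases h5 : m = ⟨n, Nat.lt_of_succ_lt h⟩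
          · left; left; rw [h5]
          · by_cases h6 : m = ⟨n + 1, h⟩
            · left; right; rw [h6]
            · right; simp [h5, h6]
        · rintro ⟨rfl, h2, h3⟩
          funext m
          by_cases h6 : m = ⟨n + 1, h⟩
          · subst h6; simpa using h2
          · by_cases h5 : m = ⟨n, Nat.lt_of_succ_lt h⟩
            · subst h5; simp [hne]
            · rcases h3 m with (h4 | h4) | h4
              · exact absurd (Fin.ext h4) h5
              · exact absurd (Fin.ext h4) h6
              · simp [h5, h6, h4]
      simp only [e1, ite_and]
      rw [Finset.sum_ite_eq']
      by_cases c1 : j ⟨n, Nat.lt_of_succ_lt h⟩ = j ⟨n + 1, h⟩ <;>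
        by_cases c2 : ∀ m : Fin N, (m.val = n ∨ m.val = n + 1) ∨ i m = j m <;>
        simp [c1, c2, hD]
    · simp [h1]
  simp only [this]
  by_cases h1 : i ⟨n, Nat.lt_of_succ_lt h⟩ = i ⟨n + 1, h⟩
  · simp only [h1, if_true, Finset.sum_mul]
    rw [Finset.sum_comm]
    simp
  · simp [h1]

theorem brauerM (hD : 2 ≤ D) (N : ℕ) : Brauer (D : ℂ) (N - 1) (sM D N) (eM D N) := by
  have hD0 : (D : ℂ) ≠ 0 := by
    have : D ≠ 0 := by omega
    exact_mod_cast this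
  exact Brauer.of_map (Matrix.toLinAlgEquiv' (R := ℂ) (n := Fin N → Fin D)).toAlgHom
    (Matrix.toLinAlgEquiv' (R := ℂ) (n := Fin N → Fin D)).injective
    (brauer_ops N _ _ (fun n h => sM_toLin N n h) (fun n h => eM_toLin hD0 N n h))

theorem sM_transpose (N n : ℕ) : (sM D N n).transpose = sM D N n :=
  embAt_transpose _ _ _ flip_transpose

theorem eM_transpose (N n : ℕ) : (eM D N n).transpose = eM D N n := by
  rw [eM, Matrix.transpose_smul, embAt_transpose _ _ _ trace_transpose]

theorem embAt_MStep (hD : 2 ≤ D) (N n k : ℕ) (h : n + 1 < N) :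
    embAt D N n (MStep D (k + 1)) = gM (D : ℂ) k (sM D N n) (eM D N n) := by
  rw [MStep, gM, embAt_smul, embAt_sub, embAt_add, embAt_one _ _ h, embAt_smul, embAt_smul, eM, sM,
    smul_smul]
  push_cast
  congr 3
  ring

theorem Pr_transpose {ι : Type*} [Fintype ι] [DecidableEq ι] (d : ℂ) (s e : ℕ → Matrix ι ι ℂ)
    (hs : ∀ n, (s n).transpose = s n) (he : ∀ n, (e n).transpose = e n) (k : ℕ) :
    (Pr d s e k).transpose = Pr d s e k := by
  induction k with
  | zero => simp [Pr]
  | succ k ih =>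
    rw [Pr, Matrix.transpose_mul, Matrix.transpose_mul, ih, mul_assoc]
    simp [gM, hs, he]

/-- uniqueness -/
theorem unique_proj {ι : Type*} [Fintype ι] [DecidableEq ι] (D : ℕ) (hD : 2 ≤ D) (K k : ℕ)
    (hk : k ≤ K) (s e s' e' : ℕ → Matrix ι ι ℂ) (H : Brauer (D : ℂ) K s e)
    (H' : Brauer (D : ℂ) K s' e')
    (hs : ∀ n, (s n).transpose = s n) (he : ∀ n, (e n).transpose = e n)
    (hs' : ∀ n, (s' n).transpose = s' n) (he' : ∀ n, (e' n).transpose = e' n)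
    (h1 : ∀ n < k, ∃ m < k, s n = s' m ∧ e n = e' m)
    (h2 : ∀ n < k, ∃ m < k, s' n = s m ∧ e' n = e m) :
    Pr (D : ℂ) s e k = Pr (D : ℂ) s' e' k := by
  have m1 := (Pr_main D hD K s e H k hk).1
  have m2 := (Pr_main D hD K s' e' H' k hk).1
  have f1 : Pr (D : ℂ) s e k * Pr (D : ℂ) s' e' k = Pr (D : ℂ) s' e' k := by
    refine Pr_fix _ _ _ _ _ (fun n hn => ?_) (fun n hn => ?_)
    · obtain ⟨m, hm, a, b⟩ := h1 n hn
      rw [a, (m2 m hm).1]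
    · obtain ⟨m, hm, a, b⟩ := h1 n hn
      rw [b, (m2 m hm).2]
  have f2 : Pr (D : ℂ) s' e' k * Pr (D : ℂ) s e k = Pr (D : ℂ) s e k := by
    refine Pr_fix _ _ _ _ _ (fun n hn => ?_) (fun n hn => ?_)
    · obtain ⟨m, hm, a, b⟩ := h2 n hn
      rw [a, (m1 m hm).1]
    · obtain ⟨m, hm, a, b⟩ := h2 n hn
      rw [b, (m1 m hm).2]
  have f3 := congrArg Matrix.transpose f2
  rw [Matrix.transpose_mul, Pr_transpose _ _ _ hs he, Pr_transpose _ _ _ hs' he'] at f3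
  rw [← f3, f1]

theorem extendLast_mul (l : ℕ) (A B : Matrix (Fin l → Fin D) (Fin l → Fin D) ℂ) :
    extendLast D l (A * B) = extendLast D l A * extendLast D l B := by
  ext i j
  rw [Matrix.mul_apply, ← (Fin.snocEquiv (fun _ : Fin (l + 1) => Fin D)).sum_comp,
    Fintype.sum_prod_type]
  simp only [extendLast, Fin.snocEquiv_apply, Fin.snoc_castSucc, Fin.snoc_last, Matrix.mul_apply,
    Finset.sum_mul]
  rw [Finset.sum_comm]
  refine Finset.sum_congr rfl fun x _ => ?_
  rw [Finset.sum_eq_single (i (Fin.last l))]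
  · simp [mul_assoc]
  · intro b _ hb
    simp [hb.symm]
  · simp

theorem extendFirst_mul (l : ℕ) (A B : Matrix (Fin l → Fin D) (Fin l → Fin D) ℂ) :
    extendFirst D l (A * B) = extendFirst D l A * extendFirst D l B := by
  ext i j
  rw [Matrix.mul_apply, ← (Fin.consEquiv (fun _ : Fin (l + 1) => Fin D)).sum_comp,
    Fintype.sum_prod_type]
  simp only [extendFirst, Fin.consEquiv_apply, Fin.cons_succ, Fin.cons_zero, Matrix.mul_apply,
    Finset.sum_mul]
  rw [Finset.sum_comm]
  refine Finset.sum_congr rfl fun x _ => ?_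
  rw [Finset.sum_eq_single (i 0)]
  · simp [mul_assoc]
  · intro b _ hb
    simp [hb.symm]
  · simp

theorem extendLast_one (l : ℕ) : extendLast D l 1 = 1 := by
  ext i j
  simp only [extendLast, Matrix.one_apply]
  rw [mul_ite, mul_one, mul_zero, ← ite_and]
  refine if_congr ?_ rfl rfl
  constructor
  · rintro ⟨h2, h1⟩
    funext m
    refine Fin.lastCases h2 (fun m => congrFun h1 m) m
  · rintro rfl
    simp

theorem extendFirst_one (l : ℕ) : extendFirst D l 1 = 1 := by
  ext i j
  simp only [extendFirst, Matrix.one_apply]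
  rw [mul_ite, mul_one, mul_zero, ← ite_and]
  refine if_congr ?_ rfl rfl
  constructor
  · rintro ⟨h2, h1⟩
    funext m
    refine Fin.cases h2 (fun m => congrFun h1 m) m
  · rintro rfl
    simp

/-- `extendLast` as an algebra homomorphism. -/
def extL (D l : ℕ) : Matrix (Fin l → Fin D) (Fin l → Fin D) ℂ →ₐ[ℂ]
    Matrix (Fin (l + 1) → Fin D) (Fin (l + 1) → Fin D) ℂ :=
  AlgHom.ofLinearMap
    { toFun := extendLast D l
      map_add' := fun A B => by ext i j; exact add_mul _ _ _
      map_smul' := fun c A => by ext i j; exact mul_assoc _ _ _ }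
    (extendLast_one l) (extendLast_mul l)

/-- `extendFirst` as an algebra homomorphism. -/
def extF (D l : ℕ) : Matrix (Fin l → Fin D) (Fin l → Fin D) ℂ →ₐ[ℂ]
    Matrix (Fin (l + 1) → Fin D) (Fin (l + 1) → Fin D) ℂ :=
  AlgHom.ofLinearMap
    { toFun := extendFirst D l
      map_add' := fun A B => by ext i j; exact add_mul _ _ _
      map_smul' := fun c A => by ext i j; exact mul_assoc _ _ _ }
    (extendFirst_one l) (extendFirst_mul l)

theorem extL_embAt (l n : ℕ) (h : n + 1 < l) (A : PairMat D) :
    extL D l (embAt D l n A) = embAt D (l + 1) n A := by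
  ext i j
  change extendLast D l (embAt D l n A) i j = _
  rw [extendLast, embAt, embAt, dif_pos h, dif_pos (by omega), Fin.prod_univ_castSucc, mul_assoc]
  have h1 : ¬ (l = n ∨ l = n + 1) := by omega
  simp only [Fin.val_castSucc, Fin.val_last, h1, if_false]
  rfl

theorem extF_embAt (l n : ℕ) (h : n + 1 < l) (A : PairMat D) :
    extF D l (embAt D l n A) = embAt D (l + 1) (n + 1) A := by
  ext i j
  change extendFirst D l (embAt D l n A) i j = _
  rw [extendFirst, embAt, embAt, dif_pos h, dif_pos (by omega), Fin.prod_univ_succ, mul_assoc]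
  simp only [Fin.val_succ, Fin.val_zero, Nat.add_right_cancel_iff]
  have h1 : ¬ (0 = n + 1 ∨ 0 = n + 1 + 1) := by omega
  simp only [h1, if_false]
  congr 1
  exact mul_comm _ _

theorem extL_Pr (l k : ℕ) (hk : k < l) : extL D l (Pr (D : ℂ) (sM D l) (eM D l) k) =
    Pr (D : ℂ) (sM D (l + 1)) (eM D (l + 1)) k := by
  rw [Pr_map]
  refine Pr_congr _ _ _ _ _ _ (fun n hn => ?_) (fun n hn => ?_)
  · exact extL_embAt _ _ (by omega) _
  · rw [eM, map_smul, extL_embAt _ _ (by omega), eM]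

theorem extF_Pr (l k : ℕ) (hk : k < l) : extF D l (Pr (D : ℂ) (sM D l) (eM D l) k) =
    Pr (D : ℂ) (fun n => sM D (l + 1) (n + 1)) (fun n => eM D (l + 1) (n + 1)) k := by
  rw [Pr_map]
  refine Pr_congr _ _ _ _ _ _ (fun n hn => ?_) (fun n hn => ?_)
  · exact extF_embAt _ _ (by omega) _
  · rw [eM, map_smul, extF_embAt _ _ (by omega), eM]

theorem symProj_eq (hD : 2 ≤ D) (k : ℕ) :
    symProj D (k + 1) = Pr (D : ℂ) (sM D (k + 1)) (eM D (k + 1)) k := by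
  induction k with
  | zero => rfl
  | succ k ih =>
    have h : extendLast D (k + 1) (symProj D (k + 1)) =
        Pr (D : ℂ) (sM D (k + 2)) (eM D (k + 2)) k := by
      rw [ih]
      exact extL_Pr (k + 1) k (by omega)
    rw [symProj, h, embAt_MStep hD _ _ _ (by omega), Pr]

theorem symProj_transpose (hD : 2 ≤ D) (l : ℕ) : (symProj D l).transpose = symProj D l := by
  cases l with
  | zero => rw [symProj, Matrix.transpose_one]
  | succ k => rw [symProj_eq hD, Pr_transpose _ _ _ (sM_transpose _) (eM_transpose _)]

theorem symProj_left (hD : 2 ≤ D) (l n : ℕ) (h : n + 1 < l) :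
    embAt D l n (symMinusMat D) * symProj D l = 0 ∧
    embAt D l n (traceMat D) * symProj D l = 0 := by
  obtain ⟨k, rfl⟩ : ∃ k, l = k + 1 := ⟨l - 1, by omega⟩
  have hD0 : (D : ℂ) ≠ 0 := by
    have : D ≠ 0 := by omega
    exact_mod_cast this
  have m := (Pr_main D hD _ _ _ (brauerM hD (k + 1)) k (by omega)).1 n (by omega)
  rw [← symProj_eq hD] at m
  constructor
  · rw [symMinusMat, embAt_smul, embAt_sub, embAt_one _ _ h, smul_mul_assoc, sub_mul, one_mul]
    rw [show embAt D (k + 1) n (flipMat D) * symProj D (k + 1) = symProj D (k + 1) from m.1]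
    simp
  · have := m.2
    rw [eM, smul_mul_assoc, smul_eq_zero] at this
    exact this.resolve_left hD0

theorem symProj_last (hD : 2 ≤ D) (l : ℕ) : symProj D (l + 2) =
      extendFirst D (l + 1) (symProj D (l + 1)) * embAt D (l + 2) 0 (MStep D (l + 1)) *
        extendFirst D (l + 1) (symProj D (l + 1)) := by
  have H := brauerM hD (l + 2)
  change Brauer (D : ℂ) (l + 1) _ _ at H
  have R := H.rev
  have hF : extendFirst D (l + 1) (symProj D (l + 1)) =
      Pr (D : ℂ) (fun n => sM D (l + 2) (l + 1 - 1 - n)) (fun n => eM D (l + 2) (l + 1 - 1 - n)) l := by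
    rw [symProj_eq hD]
    refine (extF_Pr (l + 1) l (by omega)).trans ?_
    have R' : Brauer (D : ℂ) l (fun n => sM D (l + 2) (l + 1 - 1 - n))
        (fun n => eM D (l + 2) (l + 1 - 1 - n)) := R.mono (by omega)
    refine unique_proj D hD l l le_rfl _ _ _ _ H.shift R'
      (fun n => sM_transpose _ _) (fun n => eM_transpose _ _)
      (fun n => sM_transpose _ _) (fun n => eM_transpose _ _) (fun n hn => ?_) (fun n hn => ?_)
    · refine ⟨l - 1 - n, by omega, ?_⟩
      have : l + 1 - 1 - (l - 1 - n) = n + 1 := by omega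
      simp only [this, and_self]
    · refine ⟨l - 1 - n, by omega, ?_⟩
      have : l + 1 - 1 - n = l - 1 - n + 1 := by omega
      simp only [this, and_self]
  have key : symProj D (l + 2) = Pr (D : ℂ) (fun n => sM D (l + 2) (l + 1 - 1 - n))
      (fun n => eM D (l + 2) (l + 1 - 1 - n)) (l + 1) := by
    rw [symProj_eq hD]
    refine unique_proj D hD (l + 1) (l + 1) le_rfl _ _ _ _ H R
      (fun n => sM_transpose _ _) (fun n => eM_transpose _ _)
      (fun n => sM_transpose _ _) (fun n => eM_transpose _ _) (fun n hn => ?_) (fun n hn => ?_)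
    · refine ⟨l - n, by omega, ?_⟩
      have : l + 1 - 1 - (l - n) = n := by omega
      simp only [this, and_self]
    · refine ⟨l - n, by omega, ?_⟩
      have : l + 1 - 1 - n = l - n := by omega
      simp only [this, and_self]
  have h0 : l + 1 - 1 - l = 0 := by omega
  rw [key, hF, embAt_MStep hD _ _ _ (by omega), Pr, h0]

end mats
end Fuzzy

namespace Fuzzy

/-- The recursively defined `𝒫^l` are the completely symmetric
trace-free projectors: they annihilate `𝒫⁻` and `𝒫ᵗ` on each pair of adjacent factors
(on both sides), are idempotent, are symmetric matrices, and the recursion performed on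
the *last* `l` tensor factors (with `M(l+1)` acting on the first two factors) yields
the same operator. -/
theorem statement1 (D : ℕ) (hD : 2 ≤ D) :
    (∀ l, 2 ≤ l → ∀ n, n + 1 < l →
      symProj D l * embAt D l n (symMinusMat D) = 0 ∧
      symProj D l * embAt D l n (traceMat D) = 0 ∧
      embAt D l n (symMinusMat D) * symProj D l = 0 ∧
      embAt D l n (traceMat D) * symProj D l = 0) ∧
    (∀ l, 2 ≤ l → symProj D l * symProj D l = symProj D l) ∧
    (∀ l : ℕ, ∀ i j : Fin l → Fin D, symProj D l i j = symProj D l j i) ∧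
    (∀ l : ℕ, symProj D (l + 2) =
      extendFirst D (l + 1) (symProj D (l + 1)) * embAt D (l + 2) 0 (MStep D (l + 1)) *
        extendFirst D (l + 1) (symProj D (l + 1))) := by
  have hl := symProj_left hD
  refine ⟨fun l _ n h => ⟨?_, ?_, (hl l n h).1, (hl l n h).2⟩, ?_, ?_, symProj_last hD⟩
  · have := congrArg Matrix.transpose (hl l n h).1
    rwa [Matrix.transpose_mul, symProj_transpose hD, embAt_transpose, Matrix.transpose_zero] at this
    rw [symMinusMat, Matrix.transpose_smul, Matrix.transpose_sub, Matrix.transpose_one,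
      flip_transpose]
  · have := congrArg Matrix.transpose (hl l n h).2
    rwa [Matrix.transpose_mul, symProj_transpose hD, embAt_transpose _ _ _ trace_transpose,
      Matrix.transpose_zero] at this
  · intro l h
    obtain ⟨k, rfl⟩ : ∃ k, l = k + 1 := ⟨l - 1, by omega⟩
    rw [symProj_eq hD]
    exact (Pr_main D hD _ _ _ (brauerM hD (k + 1)) k (by omega)).2
  · intro l i j
    conv_lhs => rw [← symProj_transpose hD, Matrix.transpose_apply]

end Fuzzy
end
end

section
/- For every l ≥ 0 and all indices i_1,…,i_l ∈ {1,…,D}, the polynomial X_l^{i_1…i_l} is harmonic (Δ X_l^{i_1…i_l} = 0), is an eigenvector of the square angular momentum with eigenvalue E_l (L² X_l^{i_1…i_l} = l(l+D−2)·X_l^{i_1…i_l}), is invariant under every permutation of the indices (i_1,…,i_l), and satisfies the trace relations Σ_{h=1}^D X_l^{i_1…i_{n−1} h h i_{n+2}…i_l} = 0 for each n = 1,…,l−1. -/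
open scoped BigOperators

noncomputable section
namespace Fuzzy

open MvPolynomial

/-- Complex polynomials in `E` variables. -/
abbrev Poly (E : ℕ) := MvPolynomial (Fin E) ℂ

/-- The Laplacian `Δ = Σ_i ∂_i ∂_i`. -/
def lap {E : ℕ} (φ : Poly E) : Poly E := ∑ i : Fin E, pderiv i (pderiv i φ)

/-- The angular momentum operator `L_{ij} = i (x^j ∂_i − x^i ∂_j)`. -/
def ang {E : ℕ} (i j : Fin E) (φ : Poly E) : Poly E :=
  Complex.I • (X j * pderiv i φ - X i * pderiv j φ)

/-- The square angular momentum `L² = (1/2) Σ_{i,j} L_{ij} L_{ij}`. -/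
def lsq {E : ℕ} (φ : Poly E) : Poly E :=
  (2 : ℂ)⁻¹ • ∑ i : Fin E, ∑ j : Fin E, ang i j (ang i j φ)

/-- The Euler (dilatation) operator `η = Σ_i x^i ∂_i`. -/
def eta {E : ℕ} (φ : Poly E) : Poly E := ∑ i : Fin E, X i * pderiv i φ

/-- `r² = Σ_i (x^i)²`. -/
def r2 (E : ℕ) : Poly E := ∑ i : Fin E, X i * X i

/-- The harmonic polynomials `X_l^{i_1…i_l} := 𝒫^l{}^{i_1…i_l}_{j_1…j_l} x^{j_1} ⋯ x^{j_l}`. -/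
def harmX (E l : ℕ) (i : Fin l → Fin E) : Poly E :=
  ∑ j : Fin l → Fin E, symProj E l i j • ∏ m : Fin l, X (j m)

end Fuzzy

namespace Fuzzy
open MvPolynomial

def DD {D : ℕ} (l : ℕ) (i : Fin l → Fin D) (f : Poly D) : Poly D :=
  (List.ofFn i).foldr (fun a g => pderiv a g) f

lemma pd_comm {D : ℕ} (a b : Fin D) (f : Poly D) : pderiv a (pderiv b f) = pderiv b (pderiv a f) := by
  induction f using MvPolynomial.induction_on with
  | C r => simp
  | add p q hp hq => simp [hp, hq]
  | mul_X p n h =>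
    simp only [Derivation.leibniz, smul_eq_mul, map_add, h]
    simp only [pderiv_X, Pi.single_apply]
    split_ifs <;> simp <;> ring

lemma DD_snoc {D : ℕ} (l : ℕ) (i : Fin l → Fin D) (a : Fin D) (f : Poly D) :
    DD (l+1) (Fin.snoc i a : Fin (l+1) → Fin D) f = DD l i (pderiv a f) := by
  unfold DD
  rw [List.ofFn_succ']
  simp [List.concat_eq_append]

lemma DD_zero {D : ℕ} (i : Fin 0 → Fin D) (f : Poly D) : DD 0 i f = f := by
  simp [DD]

lemma DD_perm {D : ℕ} (l : ℕ) (i : Fin l → Fin D) (σ : Equiv.Perm (Fin l)) (f : Poly D) :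
    DD l (i ∘ σ) f = DD l i f := by
  unfold DD
  have : LeftCommutative (fun (a : Fin D) (g : Poly D) => pderiv a g) :=
    ⟨fun a b g => pd_comm a b g⟩
  exact List.Perm.foldr_eq (Equiv.Perm.ofFn_comp_perm σ i) f

/-- DD as a linear map. -/
def DDl {D : ℕ} (l : ℕ) (i : Fin l → Fin D) : Poly D →ₗ[ℂ] Poly D :=
  (List.ofFn i).foldr (fun a g => (pderiv a : Derivation ℂ (Poly D) (Poly D)).toLinearMap ∘ₗ g) LinearMap.id

lemma DDl_apply {D : ℕ} (l : ℕ) (i : Fin l → Fin D) (f : Poly D) : DDl l i f = DD l i f := by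
  unfold DDl DD
  induction List.ofFn i with
  | nil => simp
  | cons a t ih => simp [ih]

lemma DD_pderiv {D : ℕ} (l : ℕ) (i : Fin l → Fin D) (a : Fin D) (f : Poly D) :
    DD l i (pderiv a f) = pderiv a (DD l i f) := by
  unfold DD
  induction List.ofFn i with
  | nil => simp
  | cons b t ih => simp [ih, pd_comm a b]

lemma sum_snoc {D : ℕ} {l : ℕ} {M : Type*} [AddCommMonoid M] (f : (Fin (l+1) → Fin D) → M) :
    ∑ J, f J = ∑ j : Fin l → Fin D, ∑ a : Fin D, f (Fin.snoc j a) := by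
  rw [← (Fin.snocEquiv (fun _ : Fin (l+1) => Fin D)).sum_comp, Fintype.sum_prod_type, Finset.sum_comm]
  rfl

/-- harmonic homogeneous -/
def Hm {D : ℕ} (l : ℕ) (f : Poly D) : Prop := f.IsHomogeneous l ∧ lap f = 0

/-- Fischer form -/
def B {D : ℕ} (l : ℕ) (f g : Poly D) : Poly D := ∑ j : Fin l → Fin D, DD l j f * DD l j g

lemma B_zero {D : ℕ} (f g : Poly D) : B 0 f g = f * g := by
  simp [B, DD_zero]

lemma B_succ {D : ℕ} (l : ℕ) (f g : Poly D) : B (l+1) f g = ∑ b, B l (pderiv b f) (pderiv b g) := by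
  unfold B
  rw [sum_snoc, Finset.sum_comm]
  simp only [DD_snoc]

lemma B_add {D : ℕ} (l : ℕ) (f g h : Poly D) : B l f (g + h) = B l f g + B l f h := by
  simp only [B, ← DDl_apply, map_add, mul_add, Finset.sum_add_distrib]

lemma B_smul {D : ℕ} (l : ℕ) (c : ℂ) (f g : Poly D) : B l f (c • g) = c • B l f g := by
  simp only [B, ← DDl_apply, map_smul, mul_smul_comm, Finset.smul_sum]

lemma B_sum {D : ℕ} (l : ℕ) {ι : Type*} (s : Finset ι) (f : Poly D) (g : ι → Poly D) :
    B l f (∑ b ∈ s, g b) = ∑ b ∈ s, B l f (g b) := by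
  simp only [B, ← DDl_apply, map_sum, Finset.mul_sum]
  rw [Finset.sum_comm]

lemma B_sum_left {D : ℕ} (l : ℕ) {ι : Type*} (s : Finset ι) (f : ι → Poly D) (g : Poly D) :
    B l (∑ b ∈ s, f b) g = ∑ b ∈ s, B l (f b) g := by
  simp only [B, ← DDl_apply, map_sum, Finset.sum_mul]
  rw [Finset.sum_comm]

lemma B_zero_left {D : ℕ} (l : ℕ) (g : Poly D) : B l 0 g = 0 := by
  simp [B, ← DDl_apply]

lemma pd_homog0 {D : ℕ} (f : Poly D) (hf : f.IsHomogeneous 0) (a : Fin D) : pderiv a f = 0 := by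
  have := totalDegree_eq_zero_iff_eq_C.mp (Nat.le_zero.mp hf.totalDegree_le)
  rw [this]; simp

lemma B_X_mul {D : ℕ} (l : ℕ) : ∀ (f K : Poly D) (_ : K.IsHomogeneous l) (b : Fin D),
    B (l+1) f (X b * K) = ((l:ℂ)+1) • B l (pderiv b f) K := by
  induction l with
  | zero =>
    intro f K hK b
    rw [B_succ]
    simp [B_zero, Derivation.leibniz, pd_homog0 K hK, pderiv_X, Pi.single_apply, mul_comm]
  | succ l ih =>
    intro f K hK b
    rw [B_succ]
    have h1 : ∀ c, B (l+1) (pderiv c f) (pderiv c (X b * K)) =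
        ((l:ℂ)+1) • B l (pderiv c (pderiv b f)) (pderiv c K) + (if c = b then B (l+1) (pderiv b f) K else 0) := by
      intro c
      rw [Derivation.leibniz, smul_eq_mul, smul_eq_mul, B_add,
        ih _ _ (by simpa using hK.pderiv (i := c)), pd_comm b c]
      congr 1
      simp only [pderiv_X, Pi.single_apply]
      split_ifs with h h' h'
      · subst h; simp
      · exact absurd h.symm h'
      · exact absurd h'.symm h
      · simp [B, ← DDl_apply]
    simp only [h1, Finset.sum_add_distrib, ← Finset.smul_sum, ← B_succ]
    simp
    module

lemma B_r2 {D : ℕ} (l : ℕ) (f q : Poly D) (hq : q.IsHomogeneous l) (hf : lap f = 0) :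
    B (l+2) f (r2 D * q) = 0 := by
  have : r2 D * q = ∑ b, X b * (X b * q) := by
    simp [r2, Finset.sum_mul, mul_assoc]
  rw [this, B_sum]
  have h1 : ∀ b, B (l+2) f (X b * (X b * q)) =
      (((l:ℂ)+2)*((l:ℂ)+1)) • B l (pderiv b (pderiv b f)) q := by
    intro b
    rw [B_X_mul (l+1) f (X b * q) (by rw [add_comm]; exact (isHomogeneous_X _ _).mul hq), B_X_mul l _ _ hq, smul_smul]
    congr 1; push_cast; ring
  simp only [h1]
  rw [← Finset.smul_sum, ← B_sum_left]
  change _ • B l (lap f) q = 0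
  rw [hf, B_zero_left, smul_zero]

lemma euler {D : ℕ} {l : ℕ} {f : Poly D} (hf : f.IsHomogeneous l) : ∑ b, X b * pderiv b f = (l:ℂ) • f := by
  rw [hf.sum_X_mul_pderiv]; simp [Nat.cast_smul_eq_nsmul]

lemma euler_pd {D : ℕ} {l : ℕ} {f : Poly D} (hf : f.IsHomogeneous l) (c : Fin D) :
    ∑ b, X b * pderiv b (pderiv c f) = ((l:ℂ) - 1) • pderiv c f := by
  cases l with
  | zero => simp [pd_homog0 f hf]
  | succ n => rw [euler (by simpa using hf.pderiv (i := c) : (pderiv c f).IsHomogeneous n)]; simp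

lemma lap_add {D : ℕ} (f g : Poly D) : lap (f+g) = lap f + lap g := by
  simp [lap, Finset.sum_add_distrib]
lemma lap_smul {D : ℕ} (c : ℂ) (f : Poly D) : lap (c • f) = c • lap f := by
  simp [lap, Finset.smul_sum]
lemma lap_sum {D : ℕ} {ι : Type*} (s : Finset ι) (f : ι → Poly D) : lap (∑ b ∈ s, f b) = ∑ b ∈ s, lap (f b) := by
  simp only [lap, map_sum]; rw [Finset.sum_comm]
lemma lap_pd {D : ℕ} (a : Fin D) (f : Poly D) : lap (pderiv a f) = pderiv a (lap f) := by
  simp only [lap, map_sum]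
  refine Finset.sum_congr rfl fun b _ => ?_
  rw [pd_comm b a, pd_comm b a]

lemma pd_Xmul {D : ℕ} (a b : Fin D) (f : Poly D) :
    pderiv a (X b * f) = X b * pderiv a f + (if a = b then f else 0) := by
  rw [Derivation.leibniz, smul_eq_mul, smul_eq_mul, pderiv_X, Pi.single_apply]
  simp only [eq_comm (a := b)]
  split_ifs <;> simp

lemma lap_Xmul {D : ℕ} (b : Fin D) (f : Poly D) :
    lap (X b * f) = X b * lap f + (2:ℂ) • pderiv b f := by
  have h : ∀ a, pderiv a (pderiv a (X b * f)) = X b * pderiv a (pderiv a f) +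
      (if a = b then (2:ℂ) • pderiv b f else 0) := by
    intro a
    rw [pd_Xmul, map_add, pd_Xmul]
    split_ifs with h
    · subst h; module
    · simp
  simp only [lap, h, Finset.sum_add_distrib, ← Finset.mul_sum]
  simp

lemma lap_r2 {D : ℕ} (f : Poly D) :
    lap (r2 D * f) = r2 D * lap f + (4:ℂ) • (∑ b, X b * pderiv b f) + (2*D:ℂ) • f := by
  have : r2 D * f = ∑ b, X b * (X b * f) := by
    simp [r2, Finset.sum_mul, mul_assoc]
  rw [this, lap_sum]
  have h : ∀ b, lap (X b * (X b * f)) = X b * X b * lap f + (4:ℂ) • (X b * pderiv b f) + (2:ℂ) • f := by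
    intro b
    rw [lap_Xmul, lap_Xmul, pd_Xmul]
    simp only [if_true, mul_add, mul_smul_comm, mul_assoc]
    module
  simp only [h, Finset.sum_add_distrib, ← Finset.smul_sum, r2, Finset.sum_mul]
  simp [Nat.cast_smul_eq_nsmul, mul_smul]

lemma pd_r2 {D : ℕ} (a : Fin D) (f : Poly D) :
    pderiv a (r2 D * f) = r2 D * pderiv a f + (2:ℂ) • (X a * f) := by
  have : r2 D * f = ∑ b, X b * (X b * f) := by
    simp [r2, Finset.sum_mul, mul_assoc]
  rw [this, map_sum]
  have h : ∀ b, pderiv a (X b * (X b * f)) = X b * X b * pderiv a f + (if a = b then (2:ℂ) • (X a * f) else 0) := by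
    intro b
    rw [pd_Xmul, pd_Xmul]
    split_ifs with h
    · subst h; rw [mul_add, mul_assoc]; module
    · simp [mul_assoc]
  simp only [h, Finset.sum_add_distrib, r2, Finset.sum_mul]
  simp

lemma lsq_harm {D : ℕ} {l : ℕ} {f : Poly D} (hf : Hm l f) :
    lsq f = ((l:ℂ) * (l + D - 2)) • f := by
  have h : ∀ i j : Fin D, ang i j (ang i j f) =
     -( X j * X j * pderiv i (pderiv i f) + X i * X i * pderiv j (pderiv j f)
      - X i * (X j * pderiv j (pderiv i f)) - X j * (X i * pderiv i (pderiv j f))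
      - X j * pderiv j f - X i * pderiv i f + (if i = j then X i * pderiv i f + X j * pderiv j f else 0)) := by
    intro i j
    simp only [ang, Derivation.map_smul, map_sub, pd_Xmul, mul_smul_comm, ← smul_sub, smul_smul, Complex.I_mul_I, neg_smul, one_smul]
    rw [pd_comm i j]
    by_cases h : i = j
    · subst h; simp; ring
    · have h' : j ≠ i := fun e => h e.symm
      simp [h, h']; ring
  have e1 : ∑ i : Fin D, ∑ j : Fin D, X j * X j * pderiv i (pderiv i f) = 0 := by
    simp only [← Finset.sum_mul, ← Finset.mul_sum]
    change _ * lap f = 0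
    rw [hf.2, mul_zero]
  have e3 : ∑ i : Fin D, ∑ j : Fin D, X i * (X j * pderiv j (pderiv i f)) = (((l:ℂ)-1)*l) • f := by
    simp only [← Finset.mul_sum, euler_pd hf.1, mul_smul_comm]
    rw [← Finset.smul_sum, euler hf.1, smul_smul]
  have e5 : ∑ i : Fin D, ∑ j : Fin D, X j * pderiv j f = (D:ℂ) • ((l:ℂ) • f) := by
    simp only [euler hf.1]; simp [Nat.cast_smul_eq_nsmul]
  simp only [lsq, h, Finset.sum_neg_distrib, Finset.sum_add_distrib, Finset.sum_sub_distrib]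
  rw [Finset.sum_comm (f := fun i j : Fin D => X i * X i * pderiv j (pderiv j f)), e1,
    Finset.sum_comm (f := fun i j : Fin D => X j * (X i * pderiv i (pderiv j f))), e3,
    Finset.sum_comm (f := fun i j : Fin D => X i * pderiv i f), e5]
  simp [Finset.sum_add_distrib, euler hf.1]
  module

end Fuzzy

namespace Fuzzy
open MvPolynomial

/-- Action of a scalar matrix on polynomial-valued tensors. -/
def act {D : ℕ} {ι : Type*} [Fintype ι] (A : Matrix ι ι ℂ) (w : ι → Poly D) (i : ι) : Poly D :=
  ∑ j, A i j • w j

lemma act_mul {D : ℕ} {ι : Type*} [Fintype ι] (A B : Matrix ι ι ℂ) (w : ι → Poly D) :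
    act (A * B) w = act A (act B w) := by
  funext i
  simp only [act, Matrix.mul_apply, Finset.sum_smul, Finset.smul_sum, smul_smul]
  rw [Finset.sum_comm]

lemma act_extendLast {D : ℕ} (l : ℕ) (A : Matrix (Fin l → Fin D) (Fin l → Fin D) ℂ)
    (w : (Fin (l+1) → Fin D) → Poly D) (i : Fin l → Fin D) (a : Fin D) :
    act (extendLast D l A) w (Fin.snoc i a) = ∑ j, A i j • w (Fin.snoc j a) := by
  simp only [act, sum_snoc, extendLast, Fin.snoc_castSucc, Fin.snoc_last]
  refine Finset.sum_congr rfl fun j _ => ?_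
  simp [Finset.sum_ite_eq, ite_smul]

lemma embAt_snoc {D : ℕ} (l : ℕ) (A : PairMat D) (i j : Fin l → Fin D) (b a b' a' : Fin D) :
    embAt D (l+2) l A (Fin.snoc (Fin.snoc i b : Fin (l+1) → Fin D) a)
      (Fin.snoc (Fin.snoc j b' : Fin (l+1) → Fin D) a') = if i = j then A (b, a) (b', a') else 0 := by
  have e1 : (⟨l, by omega⟩ : Fin (l+2)) = (Fin.last l).castSucc := rfl
  have e2 : (⟨l+1, by omega⟩ : Fin (l+2)) = Fin.last (l+1) := rfl
  unfold embAt
  rw [dif_pos (by omega), Fin.prod_univ_castSucc, Fin.prod_univ_castSucc]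
  simp only [e1, e2, Fin.snoc_castSucc, Fin.snoc_last]
  have h : ∀ m : Fin l, (if (m.castSucc.castSucc : Fin (l+2)).val = l ∨ (m.castSucc.castSucc : Fin (l+2)).val = l + 1 then (1:ℂ)
     else if i m = j m then 1 else 0) = if i m = j m then 1 else 0 := by
    intro m
    rw [if_neg]
    have := m.2
    simp; omega
  simp only [h]
  rw [Finset.prod_ite_zero]
  simp [funext_iff]

lemma act_embAt {D : ℕ} (l : ℕ) (A : PairMat D)
    (w : (Fin (l+2) → Fin D) → Poly D) (i : Fin l → Fin D) (b a : Fin D) :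
    act (embAt D (l+2) l A) w (Fin.snoc (Fin.snoc i b : Fin (l+1) → Fin D) a) =
      ∑ b', ∑ a', A (b, a) (b', a') • w (Fin.snoc (Fin.snoc i b' : Fin (l+1) → Fin D) a') := by
  unfold act
  rw [sum_snoc, sum_snoc]
  simp only [embAt_snoc]
  rw [Finset.sum_eq_single i]
  · simp
  · intro j _ hj
    simp [hj.symm]
  · simp

lemma mstep_apply {D : ℕ} (hD : 2 ≤ D) (l : ℕ) (w : Fin D → Fin D → Poly D) (b a : Fin D) :
    ∑ b', ∑ a', MStep D (l+1) (b, a) (b', a') • w b' a' =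
      ((l:ℂ)+2)⁻¹ • (w b a + ((l:ℂ)+1) • w a b -
        (if b = a then ((2 * ((l:ℂ)+1) / ((D:ℂ) + 2 * l)) • ∑ h, w h h) else 0)) := by
  have hD0 : (D:ℂ) ≠ 0 := by
    have : D ≠ 0 := by omega
    exact_mod_cast this
  have h : ∀ b' a', MStep D (l+1) (b, a) (b', a') = ((l:ℂ)+2)⁻¹ *
      ((if b = b' then (if a = a' then 1 else 0) else 0) + ((l:ℂ)+1) * (if b = a' then (if a = b' then 1 else 0) else 0)
        - (if b = a then (2 * ((l:ℂ)+1) / ((D:ℂ) + 2 * l)) else 0) * (if b' = a' then 1 else 0)) := by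
    intro b' a'
    have e : (D:ℂ) + 2 * ((l:ℂ) + 1) - 2 = D + 2 * l := by ring
    have e' : (l:ℂ) + 1 + 1 = l + 2 := by ring
    simp only [MStep, Matrix.smul_apply, Matrix.sub_apply, Matrix.add_apply, smul_eq_mul, flipMat, traceMat,
      Matrix.one_apply, Prod.mk.injEq, Nat.cast_add, Nat.cast_one, e, e', ite_and]
    congr 2
    split_ifs <;> field_simp <;> simp
  simp only [h, mul_smul, ← Finset.smul_sum]
  congr 1
  simp only [sub_smul, add_smul, Finset.sum_sub_distrib, Finset.sum_add_distrib, mul_smul, ← Finset.smul_sum, ite_smul, one_smul, zero_smul]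
  simp [Finset.sum_ite_eq, Finset.smul_sum]

lemma symProj_symm {D : ℕ} : ∀ (l : ℕ), (symProj D l).transpose = symProj D l
  | 0 => by simp [symProj]
  | 1 => by simp [symProj]
  | (l+2) => by
    have ih := symProj_symm (D := D) (l+1)
    have h1 : (extendLast D (l+1) (symProj D (l+1))).transpose = extendLast D (l+1) (symProj D (l+1)) := by
      funext i j
      have := congrFun (congrFun ih (fun m => i m.castSucc)) (fun m => j m.castSucc)
      simp only [Matrix.transpose_apply] at this
      simp only [Matrix.transpose_apply, extendLast, this, eq_comm (a := j (Fin.last (l+1)))]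
    have hM : ∀ p q, MStep D (l+1) p q = MStep D (l+1) q p := by
      rintro ⟨a, b⟩ ⟨c, d⟩
      simp only [MStep, Matrix.smul_apply, Matrix.sub_apply, Matrix.add_apply, smul_eq_mul, flipMat, traceMat,
        Matrix.one_apply, Prod.mk.injEq]
      simp only [eq_comm (a := c), eq_comm (a := d) (b := b), eq_comm (a := d) (b := a), and_comm (a := b = c)]
      ring
    have h2 : (embAt D (l+2) l (MStep D (l+1))).transpose = embAt D (l+2) l (MStep D (l+1)) := by
      funext i j
      simp only [Matrix.transpose_apply, embAt]
      rw [dif_pos (by omega), dif_pos (by omega)]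
      refine congrArg₂ _ (hM _ _) ?_
      simp only [eq_comm (a := j _)]
    rw [symProj, Matrix.transpose_mul, Matrix.transpose_mul, h1, h2, Matrix.mul_assoc]

/-- The harmonic raising of a tuple. -/
def raise {D : ℕ} (l : ℕ) (F : Fin D → Poly D) : Poly D :=
  ∑ b, X b * F b - ((D:ℂ) + 2 * l - 2)⁻¹ • (r2 D * ∑ b, pderiv b (F b))

lemma Hm_pd {D l : ℕ} {f : Poly D} (hf : Hm (l+1) f) (a : Fin D) : Hm l (pderiv a f) :=
  ⟨by simpa using hf.1.pderiv (i := a), by rw [lap_pd, hf.2, map_zero]⟩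

lemma raise_Hm {D : ℕ} (hD : 2 ≤ D) (l : ℕ) (F : Fin D → Poly D) (hF : ∀ a, Hm l (F a)) :
    Hm (l+1) (raise l F) := by
  have hh : (∑ b, X b * F b : Poly D).IsHomogeneous (l+1) := by
    refine IsHomogeneous.sum _ _ _ fun b _ => ?_
    rw [add_comm]; exact (isHomogeneous_X _ _).mul (hF b).1
  have hr : (r2 D).IsHomogeneous 2 := IsHomogeneous.sum _ _ _ fun b _ => (isHomogeneous_X _ _).mul (isHomogeneous_X _ _)
  have hlap1 : lap (∑ b, X b * F b : Poly D) = (2:ℂ) • ∑ b, pderiv b (F b) := by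
    simp [lap_sum, lap_Xmul, (hF _).2, Finset.smul_sum]
  cases l with
  | zero =>
    have : ∑ b, pderiv b (F b) = 0 := by simp [pd_homog0 _ (hF _).1]
    rw [this] at hlap1
    simp only [raise, this, mul_zero, smul_zero, sub_zero]
    exact ⟨hh, by simpa using hlap1⟩
  | succ n =>
    set q := ∑ b, pderiv b (F b) with hq
    have hqH : Hm n q := ⟨IsHomogeneous.sum _ _ _ fun b _ => (Hm_pd (hF b) b).1,
      by simp [hq, lap_sum, (Hm_pd (hF _) _).2]⟩
    have hne : (D:ℂ) + 2 * ((n+1:ℕ):ℂ) - 2 ≠ 0 := by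
      have : (D:ℂ) + 2 * ((n+1:ℕ):ℂ) - 2 = ((D + 2 * n : ℕ) : ℂ) := by push_cast; ring
      rw [this]
      have : D + 2 * n ≠ 0 := by omega
      exact_mod_cast this
    refine ⟨hh.sub ?_, ?_⟩
    · rw [smul_eq_C_mul]
      have := ((isHomogeneous_C (Fin D) (((D:ℂ) + 2 * ((n+1:ℕ):ℂ) - 2)⁻¹)).mul (hr.mul hqH.1))
      have e9 : 0 + (2 + n) = n + 1 + 1 := by omega
      rw [e9] at this
      exact this
    · have e : raise (n+1) F = ∑ b, X b * F b + (-((D:ℂ) + 2 * ((n+1:ℕ):ℂ) - 2)⁻¹) • (r2 D * q) := by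
        simp only [raise, ← hq]; module
      rw [e, lap_add, lap_smul, lap_r2, hqH.2, hlap1, euler hqH.1, smul_smul, mul_zero, zero_add, ← add_smul, smul_smul, ← add_smul]
      have : 2 + -((D:ℂ) + 2 * ((n+1:ℕ):ℂ) - 2)⁻¹ * (4 * (n:ℂ) + 2 * D) = 0 := by
        have e2 : 4 * (n:ℂ) + 2 * D = 2 * ((D:ℂ) + 2 * ((n+1:ℕ):ℂ) - 2) := by push_cast; ring
        rw [e2]; field_simp; simp
      rw [this, zero_smul]

/-- The inductive package of properties of the projector. -/
structure Good (D l : ℕ) : Prop where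
  col : ∀ j, ∃ f : Poly D, Hm l f ∧ ∀ i, (C (symProj D l i j) : Poly D) = ((l.factorial : ℂ)⁻¹) • DD l i f
  rep : ∀ g : Poly D, Hm l g → ∀ i, ∑ j, symProj D l i j • DD l j g = DD l i g

lemma Hm_B_raise {D l : ℕ} (f : Poly D) (hf : lap f = 0) (K : Fin D → Poly D) (hK : ∀ a, Hm l (K a)) :
    B (l+1) f (raise l K) = ((l:ℂ)+1) • ∑ b, B l (pderiv b f) (K b) := by
  have e : raise l K = ∑ b, X b * K b + (-((D:ℂ) + 2 * l - 2)⁻¹) • (r2 D * ∑ b, pderiv b (K b)) := by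
    simp only [raise]; module
  have e0 : B (l+1) f (r2 D * ∑ b, pderiv b (K b)) = 0 := by
    cases l with
    | zero => simp [pd_homog0 _ (hK _).1, B, ← DDl_apply]
    | succ n => exact B_r2 n f _ (IsHomogeneous.sum _ _ _ fun b _ => (Hm_pd (hK b) b).1) hf
  rw [e, B_add, B_smul, e0, smul_zero, add_zero, B_sum, Finset.smul_sum]
  exact Finset.sum_congr rfl fun b _ => B_X_mul l f (K b) (hK b).1 b

lemma good_raise {D l : ℕ} (hD : 2 ≤ D) (h : Good D (l+1)) (K : Fin D → Poly D) (hK : ∀ a, Hm l (K a))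
    (i : Fin (l+1) → Fin D) :
    ∑ j : Fin l → Fin D, ∑ b, symProj D (l+1) i (Fin.snoc j b) • DD l j (K b) =
      ((l:ℂ)+1)⁻¹ • DD (l+1) i (raise l K) := by
  obtain ⟨f, hf, hP⟩ := h.col i
  have hP' : ∀ j w, symProj D (l+1) i j • w = (((l+1).factorial : ℂ)⁻¹) • (DD (l+1) j f * w) := by
    intro j w
    have := congrFun (congrFun (symProj_symm (D := D) (l+1)) j) i
    rw [Matrix.transpose_apply] at this
    rw [smul_eq_C_mul, this, hP j, smul_mul_assoc]
  have hl : ((l:ℂ)+1) ≠ 0 := by exact_mod_cast Nat.succ_ne_zero l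
  rw [← h.rep _ (raise_Hm hD l K hK) i]
  simp only [hP', ← Finset.smul_sum]
  change _ = _ • (_ • B (l+1) f (raise l K))
  rw [Hm_B_raise f hf.2 K hK, smul_comm, smul_smul (((l:ℂ)+1)⁻¹), inv_mul_cancel₀ hl, one_smul]
  congr 1
  rw [Finset.sum_comm]
  simp only [DD_snoc, B]

lemma good_step_aux {D l : ℕ} (hD : 2 ≤ D) (h : Good D (l+1)) (F : Fin D → Poly D) (hF : ∀ a, Hm (l+1) (F a))
    (U : (Fin (l+2) → Fin D) → Poly D) (hU : ∀ j a, U (Fin.snoc j a) = DD (l+1) j (F a))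
    (i : Fin (l+1) → Fin D) (a : Fin D) :
    act (extendLast D (l + 1) (symProj D (l + 1))) (act (embAt D (l + 2) l (MStep D (l + 1))) U) (Fin.snoc i a)
      = ((l:ℂ)+2)⁻¹ • DD (l+1) i (pderiv a (raise (l+1) F)) := by
  set q := ∑ b, pderiv b (F b) with hq
  have hqH : Hm l q := ⟨IsHomogeneous.sum _ _ _ fun b _ => (Hm_pd (hF b) b).1,
      by simp [hq, lap_sum, (Hm_pd (hF _) _).2]⟩
  rw [act_extendLast, sum_snoc]
  simp only [act_embAt, mstep_apply hD, hU, DD_snoc]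
  have hs : ∀ j : Fin l → Fin D, ∑ x, DD l j (pderiv x (F x)) = DD l j q := by
    intro j; simp only [← DDl_apply, hq, map_sum]
  simp only [hs]
  have t1 := h.rep (F a) (hF a) i
  rw [sum_snoc] at t1
  simp only [DD_snoc] at t1
  have t2 := good_raise hD h (fun b => pderiv a (F b)) (fun b => Hm_pd (hF b) a) i
  have t3 := good_raise hD h (fun b => if b = a then q else 0)
    (fun b => by
      split_ifs
      · exact hqH
      · exact ⟨isHomogeneous_zero _ _ _, by simp [lap]⟩) i
  have e : ∀ (j : Fin l → Fin D) (b : Fin D),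
      symProj D (l+1) i (Fin.snoc j b) • (((l:ℂ)+2)⁻¹ • (DD l j (pderiv b (F a)) + ((l:ℂ)+1) • DD l j (pderiv a (F b))
        - if b = a then (2 * ((l:ℂ)+1) / ((D:ℂ) + 2 * l)) • DD l j q else 0)) =
      ((l:ℂ)+2)⁻¹ • (symProj D (l+1) i (Fin.snoc j b) • DD l j (pderiv b (F a))
        + ((l:ℂ)+1) • (symProj D (l+1) i (Fin.snoc j b) • DD l j (pderiv a (F b)))
        - (2 * ((l:ℂ)+1) / ((D:ℂ) + 2 * l)) • (symProj D (l+1) i (Fin.snoc j b) • DD l j (if b = a then q else 0))) := by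
    intro j b
    split_ifs
    · module
    · have : DD l j (0 : Poly D) = 0 := by rw [← DDl_apply, map_zero]
      rw [this]; module
  simp only [e, ← Finset.smul_sum, Finset.sum_add_distrib, Finset.sum_sub_distrib, t1, t2, t3]
  congr 1
  have hl : ((l:ℂ)+1) ≠ 0 := by exact_mod_cast Nat.succ_ne_zero l
  rw [smul_smul, smul_smul, mul_inv_cancel₀ hl, one_smul]
  simp only [← DDl_apply, ← map_smul, ← map_add, ← map_sub]
  congr 1
  -- polynomial identity
  have r1 : raise l (fun b => pderiv a (F b)) = ∑ b, X b * pderiv a (F b) - ((D:ℂ) + 2 * l - 2)⁻¹ • (r2 D * pderiv a q) := by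
    simp only [raise, hq, map_sum, pd_comm a]
  have r2' : raise l (fun b => if b = a then q else 0) = X a * q - ((D:ℂ) + 2 * l - 2)⁻¹ • (r2 D * pderiv a q) := by
    have : ∀ b, pderiv b (if b = a then q else 0) = if b = a then pderiv b q else 0 := by
      intro b; split_ifs <;> simp
    simp [raise, this]
  have r3 : pderiv a (raise (l+1) F) = F a + ∑ b, X b * pderiv a (F b)
      - ((D:ℂ) + 2 * l)⁻¹ • (r2 D * pderiv a q + (2:ℂ) • (X a * q)) := by
    have e : (D:ℂ) + 2 * ((l+1:ℕ):ℂ) - 2 = D + 2 * l := by push_cast; ring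
    simp only [raise, ← hq, map_sub, Derivation.map_smul, pd_r2, map_sum, pd_Xmul, e, Finset.sum_add_distrib]
    simp [add_comm]
  rw [r1, r2', r3]
  have hne : (D:ℂ) + 2 * l ≠ 0 := by
    have : D + 2 * l ≠ 0 := by omega
    exact_mod_cast this
  cases l with
  | zero =>
    simp only [pd_homog0 q hqH.1, mul_zero, smul_zero]
    have e : 2 * ((((0:ℕ):ℂ)) + 1) / ((D:ℂ) + 2 * ((0:ℕ):ℂ)) * (((0:ℕ):ℂ) + 1)⁻¹ = ((D:ℂ) + 2 * ((0:ℕ):ℂ))⁻¹ * 2 := by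
      field_simp
    rw [e]; module
  | succ n =>
    have hne' : (D:ℂ) + 2 * ((n+1:ℕ):ℂ) - 2 ≠ 0 := by
      have : (D:ℂ) + 2 * ((n+1:ℕ):ℂ) - 2 = ((D + 2 * n : ℕ) : ℂ) := by push_cast; ring
      rw [this]
      have : D + 2 * n ≠ 0 := by omega
      exact_mod_cast this
    have e : 2 * ((((n+1:ℕ):ℂ)) + 1) / ((D:ℂ) + 2 * ((n+1:ℕ):ℂ)) * (((n+1:ℕ):ℂ) + 1)⁻¹ = 2 * ((D:ℂ) + 2 * ((n+1:ℕ):ℂ))⁻¹ := by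
      field_simp
    rw [e]
    have e3 : ((D:ℂ) + 2 * ((n+1:ℕ):ℂ) - 2)⁻¹ = ((D:ℂ) + 2 * ((n+1:ℕ):ℂ))⁻¹ + 2 * ((D:ℂ) + 2 * ((n+1:ℕ):ℂ))⁻¹ * ((D:ℂ) + 2 * ((n+1:ℕ):ℂ) - 2)⁻¹ := by
      field_simp; ring
    linear_combination (norm := module) (-e3) • (r2 D * pderiv a q)

lemma exists_snoc {D l : ℕ} (I : Fin (l+1) → Fin D) : ∃ (i : Fin l → Fin D) (a : Fin D), I = Fin.snoc i a :=
  ⟨fun m => I m.castSucc, I (Fin.last l), (Fin.snoc_init_self I).symm⟩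

lemma good_step {D l : ℕ} (hD : 2 ≤ D) (h : Good D (l+1)) : Good D (l+2) := by
  constructor
  · intro J
    obtain ⟨j, b, rfl⟩ := exists_snoc J
    obtain ⟨f, hf, hP⟩ := h.col j
    have hF : ∀ a, Hm (l+1) (if a = b then f else 0 : Poly D) := by
      intro a
      split_ifs
      · exact hf
      · exact ⟨isHomogeneous_zero _ _ _, by simp [lap]⟩
    refine ⟨raise (l+1) (fun a => if a = b then f else 0), raise_Hm hD _ _ hF, fun I => ?_⟩
    obtain ⟨i, a, rfl⟩ := exists_snoc I
    have hU : ∀ (i' : Fin (l+1) → Fin D) (a' : Fin D),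
        (fun I' => ((l+1).factorial : ℂ) • (C (extendLast D (l+1) (symProj D (l+1)) I' (Fin.snoc j b)) : Poly D)) (Fin.snoc i' a')
          = DD (l+1) i' (if a' = b then f else 0) := by
      intro i' a'
      have hfac : ((l+1).factorial : ℂ) ≠ 0 := by exact_mod_cast Nat.factorial_ne_zero _
      simp only [extendLast, Fin.snoc_castSucc, Fin.snoc_last]
      split_ifs
      · rw [mul_one, hP, smul_smul, mul_inv_cancel₀ hfac, one_smul]
      · simp [← DDl_apply]
    have key := good_step_aux hD h _ hF (fun I' => ((l+1).factorial : ℂ) • (C (extendLast D (l+1) (symProj D (l+1)) I' (Fin.snoc j b)) : Poly D)) hU i a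
    rw [DD_snoc]
    have hfac : ((l+2).factorial : ℂ)⁻¹ = ((l+1).factorial : ℂ)⁻¹ * ((l:ℂ)+2)⁻¹ := by
      rw [Nat.factorial_succ, Nat.cast_mul, mul_inv, mul_comm]; push_cast; ring
    have hfac' : ((l+1).factorial : ℂ) ≠ 0 := by exact_mod_cast Nat.factorial_ne_zero _
    rw [hfac, mul_smul, ← key, ← act_mul, symProj, Matrix.mul_apply]
    simp only [act]
    rw [Finset.smul_sum, map_sum]
    refine Finset.sum_congr rfl fun K _ => ?_
    rw [smul_comm, smul_smul (((l+1).factorial : ℂ)⁻¹), inv_mul_cancel₀ hfac', one_smul, C_mul, smul_eq_C_mul]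
  · intro g hg I
    obtain ⟨i, a, rfl⟩ := exists_snoc I
    have hU : ∀ (i' : Fin (l+1) → Fin D) (a' : Fin D),
        act (extendLast D (l+1) (symProj D (l+1))) (fun J => DD (l+2) J g) (Fin.snoc i' a') = DD (l+1) i' (pderiv a' g) := by
      intro i' a'
      rw [act_extendLast]
      simp only [DD_snoc]
      exact h.rep _ (Hm_pd hg a') i'
    have key := good_step_aux hD h _ (fun a => Hm_pd hg a) _ hU i a
    rw [← act_mul, ← act_mul] at key
    change act (symProj D (l+2)) (fun J => DD (l+2) J g) _ = _
    rw [symProj, key, DD_snoc]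
    have : raise (l+1) (fun a => pderiv a g) = ((l:ℂ)+2) • g := by
      have e : ∑ b, pderiv b (pderiv b g) = 0 := hg.2
      simp only [raise, e, euler hg.1]
      simp
    have hl : ((l:ℂ)+2) ≠ 0 := by exact_mod_cast (by omega : l + 2 ≠ 0)
    rw [this, Derivation.map_smul, ← DDl_apply, map_smul, smul_smul, inv_mul_cancel₀ hl, one_smul, DDl_apply]

lemma good_all {D : ℕ} (hD : 2 ≤ D) : ∀ l, Good D l
  | 0 => ⟨fun j => ⟨1, ⟨isHomogeneous_one _ _, by simp [lap]⟩, fun i => by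
      rw [Subsingleton.elim i j]; simp [symProj, Matrix.one_apply, DD_zero]⟩, fun g _ i => by
      simp [symProj, DD_zero, Matrix.one_apply, Subsingleton.elim i default]⟩
  | 1 => ⟨fun j => ⟨X (j 0), ⟨isHomogeneous_X _ _, by
        simp only [lap, pderiv_X, Pi.single_apply]
        refine Finset.sum_eq_zero fun b _ => ?_
        split_ifs <;> simp⟩, fun i => by
      have e : i = Fin.snoc (Fin.elim0 : Fin 0 → Fin D) (i 0) := by
        funext m; rw [Subsingleton.elim m (Fin.last 0), Fin.snoc_last]; rfl
      rw [e, DD_snoc, DD_zero, ← e, pderiv_X, Pi.single_apply]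
      have : i = j ↔ j 0 = i 0 := ⟨fun h => by rw [h], fun h => by
        funext m; rw [Subsingleton.elim m 0, h]⟩
      simp only [symProj, Matrix.one_apply, this]
      split_ifs <;> simp⟩, fun g _ i => by
      simp [symProj, Matrix.one_apply, ite_smul]⟩
  | (l+2) => good_step hD (good_all hD (l+1))

end Fuzzy

namespace Fuzzy
open MvPolynomial

lemma taylor {D : ℕ} (l : ℕ) : ∀ (f : Poly D), f.IsHomogeneous l →
    ∑ j : Fin l → Fin D, DD l j f * ∏ m, X (j m) = (l.factorial : ℂ) • f := by
  induction l with
  | zero => intro f _; simp [DD_zero]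
  | succ l ih =>
    intro f hf
    rw [sum_snoc, Finset.sum_comm]
    simp only [DD_snoc, Fin.prod_univ_castSucc, Fin.snoc_castSucc, Fin.snoc_last, ← mul_assoc, ← Finset.sum_mul]
    have : ∀ a : Fin D, ∑ j : Fin l → Fin D, DD l j (pderiv a f) * ∏ m, X (j m) = (l.factorial : ℂ) • pderiv a f :=
      fun a => ih _ (by simpa using hf.pderiv (i := a))
    simp only [this, mul_comm _ (X _), mul_smul_comm]
    rw [← Finset.smul_sum, euler hf, smul_smul]
    congr 1
    rw [Nat.factorial_succ]; push_cast; ring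

lemma DD_trace {D : ℕ} (l : ℕ) (i : Fin l → Fin D) (p q : Fin l) (hpq : p ≠ q) (f : Poly D) (hf : lap f = 0) :
    ∑ h : Fin D, DD l (Function.update (Function.update i p h) q h) f = 0 := by
  obtain ⟨k, rfl⟩ : ∃ k, l = k + 2 := by
    have h1 := p.2
    have h2 := q.2
    have h3 : p.val ≠ q.val := fun e => hpq (Fin.ext e)
    exact ⟨l - 2, by omega⟩
  let la : Fin (k+2) := Fin.last (k+1)
  let pe : Fin (k+2) := (Fin.last k).castSucc
  have hlp : la ≠ pe := by simp [la, pe, Fin.ext_iff]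
  let σ : Equiv.Perm (Fin (k+2)) := Equiv.swap la q * Equiv.swap pe (Equiv.swap la q p)
  have hσp : σ pe = p := by simp [σ]
  have hσq : σ la = q := by
    have : la ≠ Equiv.swap la q p := by
      intro e
      have e2 := congrArg (Equiv.swap la q) e
      simp at e2
      exact hpq e2.symm
    simp only [σ, Equiv.Perm.mul_apply]
    rw [Equiv.swap_apply_of_ne_of_ne hlp this]
    simp
  have key : ∀ h : Fin D, (Function.update (Function.update i p h) q h) ∘ σ =
      (Fin.snoc (Fin.snoc (fun m : Fin k => i (σ m.castSucc.castSucc)) h : Fin (k+1) → Fin D) h : Fin (k+2) → Fin D) := by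
    intro h
    funext m
    refine Fin.lastCases ?_ (fun m' => ?_) m
    · rw [Fin.snoc_last, Function.comp_apply]
      have e : σ (Fin.last (k+1)) = q := hσq
      rw [e]; simp
    · rw [Fin.snoc_castSucc]
      refine Fin.lastCases ?_ (fun m'' => ?_) m'
      · rw [Fin.snoc_last, Function.comp_apply]
        have e : σ (Fin.last k).castSucc = p := hσp
        rw [e]; simp [hpq]
      · rw [Fin.snoc_castSucc, Function.comp_apply]
        have n1 : σ m''.castSucc.castSucc ≠ q := by
          rw [← hσq]; intro e
          have := congrArg Fin.val (σ.injective e)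
          have := m''.2
          simp only [la, Fin.val_castSucc, Fin.val_last] at *; omega
        have n2 : σ m''.castSucc.castSucc ≠ p := by
          rw [← hσp]; intro e
          have := congrArg Fin.val (σ.injective e)
          have := m''.2
          simp only [pe, Fin.val_castSucc, Fin.val_last] at *; omega
        rw [Function.update_of_ne n1, Function.update_of_ne n2]
  have : ∀ h : Fin D, DD (k+2) (Function.update (Function.update i p h) q h) f =
      DD k (fun m : Fin k => i (σ m.castSucc.castSucc)) (pderiv h (pderiv h f)) := by
    intro h
    rw [← DD_perm _ _ σ, key, DD_snoc, DD_snoc]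
  simp only [this, ← DDl_apply, ← map_sum]
  change DDl _ _ (lap f) = 0
  rw [hf, map_zero]

lemma harmX_Hm {D : ℕ} (hD : 2 ≤ D) (l : ℕ) (i : Fin l → Fin D) : Hm l (harmX D l i) := by
  obtain ⟨f, hf, hP⟩ := (good_all hD l).col i
  have hfac : (l.factorial : ℂ) ≠ 0 := by exact_mod_cast Nat.factorial_ne_zero _
  have : harmX D l i = f := by
    unfold harmX
    have e : ∀ j, symProj D l i j • (∏ m, X (j m) : Poly D) = (l.factorial : ℂ)⁻¹ • (DD l j f * ∏ m, X (j m)) := by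
      intro j
      have := congrFun (congrFun (symProj_symm (D := D) l) j) i
      rw [Matrix.transpose_apply] at this
      rw [smul_eq_C_mul, this, hP j, smul_mul_assoc]
    simp only [e, ← Finset.smul_sum, taylor l f hf.1]
    rw [smul_smul, inv_mul_cancel₀ hfac, one_smul]
  rw [this]; exact hf

end Fuzzy

namespace Fuzzy

/-- The polynomials `X_l^{i_1…i_l}` are harmonic, are eigenvectors of
the square angular momentum `L²` with eigenvalue `E_l = l(l+D−2)`, are invariant under
every permutation of their indices, and are trace-free in every pair of adjacent
indices. -/
theorem statement3 (D : ℕ) (hD : 2 ≤ D) (l : ℕ) (i : Fin l → Fin D) :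
    lap (harmX D l i) = 0 ∧
    lsq (harmX D l i) = ((l * (l + D - 2) : ℕ) : ℂ) • harmX D l i ∧
    (∀ σ : Equiv.Perm (Fin l), harmX D l (i ∘ σ) = harmX D l i) ∧
    (∀ n : ℕ, ∀ hn : n + 1 < l,
      ∑ h : Fin D,
        harmX D l
          (Function.update (Function.update i ⟨n, Nat.lt_of_succ_lt hn⟩ h) ⟨n + 1, hn⟩ h)
        = 0) := by
  have hH := harmX_Hm hD l i
  have hg := good_all hD l
  refine ⟨hH.2, ?_, ?_, ?_⟩
  · rw [lsq_harm hH]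
    congr 1
    rw [Nat.cast_mul, Nat.cast_sub (by omega)]
    push_cast; ring
  · intro σ
    unfold harmX
    refine Finset.sum_congr rfl fun j _ => ?_
    obtain ⟨f, hf, hP⟩ := hg.col j
    congr 1
    apply MvPolynomial.C_injective (Fin D) ℂ
    rw [hP, hP, DD_perm]
  · intro n hn
    unfold harmX
    rw [Finset.sum_comm]
    refine Finset.sum_eq_zero fun j _ => ?_
    obtain ⟨f, hf, hP⟩ := hg.col j
    simp only [MvPolynomial.smul_eq_C_mul _ (symProj _ _ _ _), hP, ← Finset.sum_mul]
    rw [← Finset.smul_sum, DD_trace l i ⟨n, Nat.lt_of_succ_lt hn⟩ ⟨n + 1, hn⟩ (by simp [Fin.ext_iff]) f hf.2,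
      smul_zero, zero_mul]

end Fuzzy
end
end
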